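/- Let 1∈E be an even vector and 𝐓=(T,T̄) an even pair of operators on E, and let a(𝐳), b(𝐳) be local homogeneous End(E)-valued distributions that are creative and translation covariant for 1 and 𝐓. Then for every 𝐧∈K² the product field a(𝐳)_(𝐧)b(𝐳) is creative and translation covariant for 1 and 𝐓, and s_1(a(𝐳)_(𝐧)b(𝐳)) = a_𝐧(s_1 b(𝐳)). -/

import Mathlib

open scoped BigOperators Classical

noncomputable section

namespace OPEA

variable (K : Type*) [Field K] [CharZero K]

/-- index pairs 𝐧 = (n, n̄) ∈ K² -/
abbrev Idx := K × K

def IsInt (x : K) : Prop := ∃ k : ℤ, (k : K) = x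

def IsNegInt (x : K) : Prop := ∃ k : ℤ, k < 0 ∧ (k : K) = x

/-- 𝕂̄ = {𝐧 ∈ K² | n − n̄ ∈ ℤ} -/
def Kbar (n : Idx K) : Prop := IsInt K (n.1 - n.2)

def IsIntPair (n : Idx K) : Prop := IsInt K n.1 ∧ IsInt K n.2

/-- generalized binomial coefficient C(x,k) -/
def gchoose (x : K) (k : ℕ) : K :=
  (∏ i ∈ Finset.range k, (x - (i : K))) / (k.factorial : K)

/-- (−1)^x for x an integer image in K (and 1 otherwise) -/
def negOnePow (x : K) : K :=
  if h : ∃ k : ℤ, (k : K) = x then (-1 : K) ^ h.choose else 1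

variable (M : Type*) [AddCommGroup M] [Module K M]

/-- M-valued distribution in one variable pair -/
abbrev Dist1 := Idx K → M

/-- M-valued distribution in two variable pairs -/
abbrev Dist2 := Idx K → Idx K → M

/-- M-valued distribution in r variable pairs -/
abbrev DistN (r : ℕ) := (Fin r → Idx K) → M

/-- membership in M[[𝐳]] -/
def IsPow1 (a : Dist1 K M) : Prop := ∀ n, a n ≠ 0 → IsNegInt K n.1 ∧ IsNegInt K n.2

/-- membership in M⌊𝐳⌋ -/
def InLat1 (a : Dist1 K M) : Prop :=
  ∃ S : Finset (Idx K), ∀ n, a n ≠ 0 →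
    ∃ m ∈ S, IsNegInt K (n.1 - m.1) ∧ IsNegInt K (n.2 - m.2)

/-- membership in M[[𝐳,𝐰]] -/
def IsPow2 (a : Dist2 K M) : Prop :=
  ∀ n k, a n k ≠ 0 →
    (IsNegInt K n.1 ∧ IsNegInt K n.2) ∧ (IsNegInt K k.1 ∧ IsNegInt K k.2)

/-- membership in M⌊𝐳,𝐰⌋ -/
def InLat2 (a : Dist2 K M) : Prop :=
  ∃ S : Finset (Idx K × Idx K), ∀ n k, a n k ≠ 0 →
    ∃ m ∈ S, (IsNegInt K (n.1 - m.1.1) ∧ IsNegInt K (n.2 - m.1.2)) ∧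
      (IsNegInt K (k.1 - m.2.1) ∧ IsNegInt K (k.2 - m.2.2))

/-- membership in M[[𝐳₁,…,𝐳ᵣ]] -/
def IsPowN {r : ℕ} (a : DistN K M r) : Prop :=
  ∀ n, a n ≠ 0 → ∀ i, IsNegInt K (n i).1 ∧ IsNegInt K (n i).2

/-- membership in M⌊𝐳₁,…,𝐳ᵣ⌋ -/
def InLatN {r : ℕ} (a : DistN K M r) : Prop :=
  ∃ S : Finset (Fin r → Idx K), ∀ n, a n ≠ 0 →
    ∃ m ∈ S, ∀ i, IsNegInt K ((n i).1 - (m i).1) ∧ IsNegInt K ((n i).2 - (m i).2)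

/-- ∂_z -/
def dz (a : Dist1 K M) : Dist1 K M := fun n => (-n.1) • a (n.1 - 1, n.2)

/-- ∂_z̄ -/
def dzb (a : Dist1 K M) : Dist1 K M := fun n => (-n.2) • a (n.1, n.2 - 1)

/-- ∂ in the first variable pair of a two-variable distribution (z-component) -/
def d1z (c : Dist2 K M) : Dist2 K M := fun n k => (-n.1) • c (n.1 - 1, n.2) k

/-- ∂ in the first variable pair of a two-variable distribution (z̄-component) -/
def d1zb (c : Dist2 K M) : Dist2 K M := fun n k => (-n.2) • c (n.1, n.2 - 1) k

/-- divided power d^{(x)} of an operator d, for a K-valued exponent x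
(zero unless x ∈ ℕ) -/
def dPow {A : Type*} [AddCommGroup A] [Module K A] (d : A → A) (x : K) (a : A) : A :=
  if h : ∃ j : ℕ, (j : K) = x then ((h.choose.factorial : K))⁻¹ • d^[h.choose] a else 0

/-- ∂_z^{(e_1)} ∂_z̄^{(e_2)} in the first variable pair -/
def ddPow2 (e : Idx K) (c : Dist2 K M) : Dist2 K M :=
  dPow K (d1z K M) e.1 (dPow K (d1zb K M) e.2 c)

/-- the diagonal map c(𝐳,𝐰) ↦ c(𝐰,𝐰) -/
def diag (c : Dist2 K M) : Dist1 K M :=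
  fun n => ∑ᶠ m : Idx K, c m (n.1 - m.1 - 1, n.2 - m.2 - 1)

/-- multiplication by (𝐳−𝐰)^h (expansion in z>w), on coefficients;
first index is 𝐳, second is 𝐰 -/
def zwPow (h : Idx K) (c : Dist2 K M) : Dist2 K M :=
  fun m k => ∑ᶠ i : ℕ × ℕ,
    ((-1 : K) ^ (i.1 + i.2) * gchoose K h.1 i.1 * gchoose K h.2 i.2) •
      c (m.1 + h.1 - i.1, m.2 + h.2 - i.2) (k.1 + i.1, k.2 + i.2)

/-- multiplication by ((𝐳−𝐰)_{w>z})^h = (−1)^h (𝐰−𝐳)^h (expansion in w>z) -/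
def zwPowW (h : Idx K) (c : Dist2 K M) : Dist2 K M :=
  fun m k => ∑ᶠ i : ℕ × ℕ,
    (negOnePow K (h.1 - h.2) * (-1 : K) ^ (i.1 + i.2) *
        gchoose K h.1 i.1 * gchoose K h.2 i.2) •
      c (m.1 + i.1, m.2 + i.2) (k.1 + h.1 - i.1, k.2 + h.2 - i.2)

/-- multiplication by (𝐱+𝐰)^N of a distribution d(𝐰,𝐱) (first index 𝐰, second 𝐱);
the result is indexed by (x-index, w-index) -/
def xwPow (N : Idx K) (d : Dist2 K M) : Dist2 K M :=
  fun m k => ∑ᶠ i : ℕ × ℕ, (gchoose K N.1 i.1 * gchoose K N.2 i.2) •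
    d (k.1 + i.1, k.2 + i.2) (m.1 + N.1 - i.1, m.2 + N.2 - i.2)

/-- multiplication by (𝐰+𝐱)^N of a distribution d(𝐰,𝐱) (first index 𝐰, second 𝐱);
the result is indexed by (x-index, w-index) -/
def wxPow (N : Idx K) (d : Dist2 K M) : Dist2 K M :=
  fun m k => ∑ᶠ i : ℕ × ℕ, (gchoose K N.1 i.1 * gchoose K N.2 i.2) •
    d (k.1 + N.1 - i.1, k.2 + N.2 - i.2) (m.1 + i.1, m.2 + i.2)

/-- multiplication by 𝐱^A 𝐰^B (𝐱+𝐰)^N of p(𝐰,𝐱); result indexed (x-index, w-index) -/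
def tripleXW (A B N : Idx K) (p : Dist2 K M) : Dist2 K M :=
  fun m k => ∑ᶠ l : ℕ × ℕ, (gchoose K N.1 l.1 * gchoose K N.2 l.2) •
    p (k.1 + B.1 + l.1, k.2 + B.2 + l.2) (m.1 + A.1 + N.1 - l.1, m.2 + A.2 + N.2 - l.2)

/-- multiplication by 𝐱^A 𝐰^B (𝐰+𝐱)^N of p(𝐰,𝐱); result indexed (x-index, w-index) -/
def tripleWX (A B N : Idx K) (p : Dist2 K M) : Dist2 K M :=
  fun m k => ∑ᶠ l : ℕ × ℕ, (gchoose K N.1 l.1 * gchoose K N.2 l.2) •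
    p (k.1 + B.1 + N.1 - l.1, k.2 + B.2 + N.2 - l.2) (m.1 + A.1 + l.1, m.2 + A.2 + l.2)

variable (E : Type*) [AddCommGroup E] [Module K E]

/-- End(E)-valued distributions in one variable pair -/
abbrev EDist1 := Dist1 K (Module.End K E)

/-- End(E)-valued distributions in two variable pairs -/
abbrev EDist2 := Dist2 K (Module.End K E)

/-- End(E)-valued distributions in r variable pairs -/
abbrev EDistN (r : ℕ) := DistN K (Module.End K E) r

def ev1 (a : EDist1 K E) (v : E) : Dist1 K E := fun n => a n v

def ev2 (c : EDist2 K E) (v : E) : Dist2 K E := fun n k => c n k v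

def evN {r : ℕ} (c : EDistN K E r) (v : E) : DistN K E r := fun n => c n v

/-- a(𝐳) is a field -/
def IsFieldD (a : EDist1 K E) : Prop := ∀ v, InLat1 K E (ev1 K E a v)

/-- a field in two variable pairs -/
def IsField2D (c : EDist2 K E) : Prop := ∀ v, InLat2 K E (ev2 K E c v)

/-- the Koszul sign (−1)^{pq} -/
def koszul (p q : ZMod 2) : K := if p = 1 ∧ q = 1 then (-1 : K) else 1

/-- the data (c^i, 𝐡_i) is an OPE of the homogeneous distributions a(𝐳), b(𝐳)
of parities pa, pb (all identities to be read applied to each vector of E) -/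
def IsOPE (pa pb : ZMod 2) (a b : EDist1 K E) {r : ℕ}
    (c : Fin r → EDist2 K E) (h : Fin r → Idx K) : Prop :=
  (∀ i, Kbar K (h i)) ∧ (∀ i, IsField2D K E (c i)) ∧
  (∀ v m k, a m (b k v) = ∑ i, zwPow K E (-(h i)) (ev2 K E (c i) v) m k) ∧
  (∀ v m k, koszul K pa pb • (b k (a m v)) =
      ∑ i, zwPowW K E (-(h i)) (ev2 K E (c i) v) m k)

/-- a(𝐳), b(𝐳) (homogeneous of parities pa, pb) are local -/
def IsLocal (pa pb : ZMod 2) (a b : EDist1 K E) : Prop :=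
  ∃ (r : ℕ) (c : Fin r → EDist2 K E) (h : Fin r → Idx K), IsOPE K E pa pb a b c h

/-- the exponents of an OPE are reduced: 𝐡_i ∉ 𝐡_j + ℤ² for i ≠ j -/
def ReducedExp {r : ℕ} (h : Fin r → Idx K) : Prop :=
  ∀ i j, i ≠ j → ¬ IsIntPair K (h i - h j)

/-- the product field a(𝐰)_{(𝐧)}b(𝐰) built from an OPE (c,h), applied to a vector v -/
def prodAt {r : ℕ} (c : Fin r → EDist2 K E) (h : Fin r → Idx K) (n : Idx K)
    (v : E) : Dist1 K E :=
  fun m => ∑ i, diag K E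
    (ddPow2 K E ((h i).1 - 1 - n.1, (h i).2 - 1 - n.2) (ev2 K E (c i) v)) m

/-- s₁ : a(𝐳) ↦ a_{(−1,−1)}1 -/
def s1 (one : E) (a : EDist1 K E) : E := a ((-1 : K), (-1 : K)) one

/-- the distribution d (to be thought of as a(𝐳)1) equals
Σ_{𝐢∈ℕ²} T^{(i)} T̄^{(ī)} (d_{(−1,−1)}) 𝐳^𝐢, i.e. a(𝐳) is creative -/
def CreativeD (T Tb : Module.End K E) (d : Dist1 K E) : Prop :=
  (∀ i : ℕ × ℕ, d (-(i.1 : K) - 1, -(i.2 : K) - 1) =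
      ((i.1.factorial : K)⁻¹ * (i.2.factorial : K)⁻¹) •
        ((T ^ i.1) * (Tb ^ i.2)) (d ((-1 : K), (-1 : K)))) ∧
  (∀ n : Idx K, (¬ ∃ i : ℕ × ℕ, n = (-(i.1 : K) - 1, -(i.2 : K) - 1)) → d n = 0)

/-- a(𝐳) is translation covariant for (T, T̄) -/
def TransCov (T Tb : Module.End K E) (a : EDist1 K E) : Prop :=
  (∀ n : Idx K, T * a n - a n * T = (-n.1) • a (n.1 - 1, n.2)) ∧
  (∀ n : Idx K, Tb * a n - a n * Tb = (-n.2) • a (n.1, n.2 - 1))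

/-- translation covariance of a product field, per vector -/
def TransCovAt (T Tb : Module.End K E) (P : E → Dist1 K E) : Prop :=
  (∀ v (m : Idx K), T (P v m) - P (T v) m = (-m.1) • P v (m.1 - 1, m.2)) ∧
  (∀ v (m : Idx K), Tb (P v m) - P (Tb v) m = (-m.2) • P v (m.1, m.2 - 1))

/-- the identity field 1(z) = id_E -/
def idField : EDist1 K E :=
  fun n => if n = ((-1 : K), (-1 : K)) then (1 : Module.End K E) else 0

/-- pairs i < j in [r] -/
abbrev Pairs (r : ℕ) := {p : Fin r × Fin r // p.1 < p.2}

/-- the index shift of the i-th variable produced by the monomial of a binomial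
expansion of ((𝐳_{p₁} − 𝐳_{p₂})_σ)^h belonging to 𝐤 ∈ ℕ² -/
def pairShift {r : ℕ} (p : Pairs r) (h : Idx K) (flip : Bool) (kk : ℕ × ℕ)
    (i : Fin r) : Idx K :=
  if i = p.1.1 then
    (if flip then ((kk.1 : K), (kk.2 : K)) else (h.1 - kk.1, h.2 - kk.2))
  else if i = p.1.2 then
    (if flip then (h.1 - kk.1, h.2 - kk.2) else ((kk.1 : K), (kk.2 : K)))
  else 0

/-- the coefficient of a binomial expansion of ((𝐳_{p₁} − 𝐳_{p₂})_σ)^h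
belonging to 𝐤 ∈ ℕ² -/
def pairCoef (h : Idx K) (flip : Bool) (kk : ℕ × ℕ) : K :=
  (if flip then negOnePow K (h.1 - h.2) else 1) * (-1 : K) ^ (kk.1 + kk.2) *
    gchoose K h.1 kk.1 * gchoose K h.2 kk.2

def flipOf {r : ℕ} (σ : Equiv.Perm (Fin r)) (p : Pairs r) : Bool :=
  decide (σ.symm p.1.2 < σ.symm p.1.1)

/-- multiplication by Π_{i<j} ((𝐳_i − 𝐳_j)_σ)^{h_{ij}} on an r-variable distribution -/
def permMul {r : ℕ} (σ : Equiv.Perm (Fin r)) (hs : Pairs r → Idx K)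
    (c : DistN K M r) : DistN K M r :=
  fun m => ∑ᶠ κ : Pairs r → ℕ × ℕ,
    (∏ p : Pairs r, pairCoef K (hs p) (flipOf σ p) (κ p)) •
      c (fun i => m i + ∑ p : Pairs r, pairShift K p (hs p) (flipOf σ p) (κ p) i)

/-- the Koszul sign ζ' produced by reordering a¹,…,aʳ into a^{σ1},…,a^{σr} -/
def koszulPerm {r : ℕ} (ps : Fin r → ZMod 2) (σ : Equiv.Perm (Fin r)) : K :=
  ∏ p : Pairs r,
    if σ.symm p.1.2 < σ.symm p.1.1 ∧ ps p.1.1 = 1 ∧ ps p.1.2 = 1 then (-1 : K) else 1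

/-- the composition a^{σ1}(𝐳_{σ1})_{m_{σ1}} ∘ ⋯ ∘ a^{σr}(𝐳_{σr})_{m_{σr}} applied to v -/
def compSeq {r : ℕ} (a : Fin r → EDist1 K E) (σ : Equiv.Perm (Fin r))
    (m : Fin r → Idx K) (v : E) : E :=
  (List.ofFn fun j : Fin r => σ j).foldr (fun i acc => a i (m i) acc) v

/-- the data (c^α, 𝐡_{ij}^k) is a (multiple) OPE of the homogeneous distributions
a¹(𝐳),…,aʳ(𝐳) of parities ps -/
def IsMultOPE {r : ℕ} (a : Fin r → EDist1 K E) (ps : Fin r → ZMod 2)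
    (rij : Fin r → Fin r → ℕ) (hs : ∀ i j : Fin r, Fin (rij i j) → Idx K)
    (c : ((p : Pairs r) → Fin (rij p.1.1 p.1.2)) → EDistN K E r) : Prop :=
  (∀ i j k, Kbar K (hs i j k)) ∧
  (∀ α v, InLatN K E (evN K E (c α) v)) ∧
  (∀ σ : Equiv.Perm (Fin r), ∀ v m,
    koszulPerm K ps σ • compSeq K E a σ m v =
      ∑ α : (p : Pairs r) → Fin (rij p.1.1 p.1.2),
        permMul K E σ (fun p => -(hs p.1.1 p.1.2 (α p))) (evN K E (c α) v) m)

/-- a¹(𝐳),…,aʳ(𝐳) are multiply local -/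
def MultiplyLocal {r : ℕ} (a : Fin r → EDist1 K E) (ps : Fin r → ZMod 2) : Prop :=
  ∃ (rij : Fin r → Fin r → ℕ) (hs : ∀ i j : Fin r, Fin (rij i j) → Idx K)
    (c : ((p : Pairs r) → Fin (rij p.1.1 p.1.2)) → EDistN K E r),
      IsMultOPE K E a ps rij hs c

/-- a set of homogeneous fields (with parities pF) is multiply local -/
def MultLocalSet (F : Set (EDist1 K E)) (pF : EDist1 K E → ZMod 2) : Prop :=
  ∀ (r : ℕ) (f : Fin r → EDist1 K E), (∀ i, f i ∈ F) →
    MultiplyLocal K E f (fun i => pF (f i))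

/-- a set of homogeneous fields (with parities pF) is uniformly local -/
def UnifLocalSet (F : Set (EDist1 K E)) (pF : EDist1 K E → ZMod 2) (one : E) : Prop :=
  ∃ (rr : EDist1 K E → EDist1 K E → ℕ)
    (hh : ∀ d e : EDist1 K E, Fin (rr d e) → Idx K),
    ∀ (r : ℕ) (f : Fin r → EDist1 K E), (∀ i, f i ∈ F) →
      ∃ c, IsMultOPE K E f (fun i => pF (f i)) (fun i j => rr (f i) (f j))
          (fun i j => hh (f i) (f j)) c ∧
        ∀ α, IsPowN K E (evN K E (c α) one)

/-- a ∈ V is homogeneous of parity p w.r.t. the grading (ev, od) -/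
def memPar {V : Type*} [AddCommGroup V] [Module K V] (ev od : Submodule K V)
    (a : V) (p : ZMod 2) : Prop :=
  (p = 0 ∧ a ∈ ev) ∨ (p = 1 ∧ a ∈ od)

/-- an endomorphism is homogeneous of parity p w.r.t. the grading (ev, od) -/
def EndPar {V : Type*} [AddCommGroup V] [Module K V] (ev od : Submodule K V)
    (f : Module.End K V) (p : ZMod 2) : Prop :=
  if p = 0 then (∀ v ∈ ev, f v ∈ ev) ∧ (∀ v ∈ od, f v ∈ od)
  else (∀ v ∈ ev, f v ∈ od) ∧ (∀ v ∈ od, f v ∈ ev)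

/-- a distribution is homogeneous of parity p -/
def EDistPar {V : Type*} [AddCommGroup V] [Module K V] (ev od : Submodule K V)
    (a : EDist1 K V) (p : ZMod 2) : Prop :=
  ∀ n, EndPar K ev od (a n) p

end OPEA

namespace OPEA

/-- an OPE-algebra -/
structure OPEAlg (K : Type*) [Field K] [CharZero K]
    (V : Type*) [AddCommGroup V] [Module K V] where
  ev : Submodule K V
  od : Submodule K V
  compl : IsCompl ev od
  Y : V →ₗ[K] EDist1 K V
  Y_par : ∀ a p, memPar K ev od a p → ∀ (n : Idx K) b q, memPar K ev od b q →
    memPar K ev od (Y a n b) (p + q)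
  one : V
  one_ev : one ∈ ev
  T : Module.End K V
  Tb : Module.End K V
  T_ev : EndPar K ev od T 0
  Tb_ev : EndPar K ev od Tb 0
  commTTb : T * Tb = Tb * T
  T_one : T one = 0
  Tb_one : Tb one = 0
  wcre : ∀ a, IsPow1 K V (ev1 K V (Y a) one)
  rid : ∀ a, Y a ((-1 : K), (-1 : K)) one = a
  tcov : ∀ a, TransCov K V T Tb (Y a)
  loc : ∀ a b pa pb, memPar K ev od a pa → memPar K ev od b pb →
    IsLocal K V pa pb (Y a) (Y b)

/-- a bounded 𝕂̄-fold algebra -/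
structure BFold (K : Type*) [Field K] [CharZero K]
    (V : Type*) [AddCommGroup V] [Module K V] where
  ev : Submodule K V
  od : Submodule K V
  compl : IsCompl ev od
  Y : V →ₗ[K] EDist1 K V
  Y_par : ∀ a p, memPar K ev od a p → ∀ (n : Idx K) b q, memPar K ev od b q →
    memPar K ev od (Y a n b) (p + q)
  fields : ∀ a, IsFieldD K V (Y a)
  bounded : ∀ a (n : Idx K), ¬ Kbar K n → ∀ b, Y a n b = 0

/-- a bounded 𝕂̄-fold module over a bounded 𝕂̄-fold algebra -/
structure BMod (K : Type*) [Field K] [CharZero K]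
    (V : Type*) [AddCommGroup V] [Module K V] (A : BFold K V)
    (Mo : Type*) [AddCommGroup Mo] [Module K Mo] where
  evM : Submodule K Mo
  odM : Submodule K Mo
  complM : IsCompl evM odM
  YM : V →ₗ[K] EDist1 K Mo
  YM_par : ∀ a p, memPar K A.ev A.od a p → ∀ n : Idx K, EndPar K evM odM (YM a n) p
  fieldsM : ∀ a, IsFieldD K Mo (YM a)
  boundedM : ∀ a (n : Idx K), ¬ Kbar K n → ∀ c, YM a n c = 0

variable (K : Type*) [Field K] [CharZero K]
variable (V : Type*) [AddCommGroup V] [Module K V]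
variable (Mo : Type*) [AddCommGroup Mo] [Module K Mo]

/-- the operator T₁ : a ↦ a_{(−2,−1)}1 of an OPE-algebra -/
def T1 (A : OPEAlg K V) : Module.End K V where
  toFun := fun a => A.Y a ((-2 : K), (-1 : K)) A.one
  map_add' := by
    intro x y
    simp [map_add, Pi.add_apply, LinearMap.add_apply]
  map_smul' := by
    intro c x
    simp [map_smul, Pi.smul_apply, LinearMap.smul_apply]

/-- the operator T̄₁ : a ↦ a_{(−1,−2)}1 of an OPE-algebra -/
def T1b (A : OPEAlg K V) : Module.End K V where
  toFun := fun a => A.Y a ((-1 : K), (-2 : K)) A.one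
  map_add' := by
    intro x y
    simp [map_add, Pi.add_apply, LinearMap.add_apply]
  map_smul' := by
    intro c x
    simp [map_smul, Pi.smul_apply, LinearMap.smul_apply]

/-- skew-symmetry for the pair (T, T̄) -/
def SkewSym (ev od : Submodule K V) (Yf : V → EDist1 K V)
    (T Tb : Module.End K V) : Prop :=
  ∀ a b pa pb, memPar K ev od a pa → memPar K ev od b pb →
    ∀ n : Idx K, Kbar K n →
      (Function.support (fun i : ℕ × ℕ =>
        ((i.1.factorial : K)⁻¹ * (i.2.factorial : K)⁻¹ *
            negOnePow K (n.1 + i.1 - (n.2 + i.2))) •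
          ((T ^ i.1) * (Tb ^ i.2)) (Yf a (n.1 + i.1, n.2 + i.2) b))).Finite ∧
      koszul K pa pb • Yf b n a =
        ∑ᶠ i : ℕ × ℕ, ((i.1.factorial : K)⁻¹ * (i.2.factorial : K)⁻¹ *
            negOnePow K (n.1 + i.1 - (n.2 + i.2))) •
          ((T ^ i.1) * (Tb ^ i.2)) (Yf a (n.1 + i.1, n.2 + i.2) b)

/-- (T, T̄) is a translation endomorphism of the module with state-field map YM -/
def TransEnd (YM : V → EDist1 K Mo) (T Tb : Module.End K V) : Prop :=
  (∀ a (n : Idx K), YM (T a) n = (-n.1) • YM a (n.1 - 1, n.2)) ∧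
  (∀ a (n : Idx K), YM (Tb a) n = (-n.2) • YM a (n.1, n.2 - 1))

/-- the coefficient at (x-index m, w-index k) of a(𝐱+𝐰) applied to the w-distribution bw -/
def lhsXW (YM : V → EDist1 K Mo) (a : V) (bw : Dist1 K Mo) (m k : Idx K) : Mo :=
  ∑ᶠ i : ℕ × ℕ, ((i.1.factorial : K)⁻¹ * (i.2.factorial : K)⁻¹) •
    (((dz K (Module.End K Mo))^[i.1] ((dzb K (Module.End K Mo))^[i.2] (YM a))) m)
      (bw (k.1 + i.1, k.2 + i.2))

/-- a and cM are dual in the direct channel -/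
def DualDirect (Y : V → EDist1 K V) (YM : V → EDist1 K Mo) (a : V) (cM : Mo) : Prop :=
  ∃ (s : ℕ) (d : Fin s → Idx K → Idx K → (V →ₗ[K] Mo)) (hj : Fin s → Idx K),
    (∀ j, Kbar K (hj j)) ∧
    (∀ j b, InLat2 K Mo (fun kw mx => d j kw mx b)) ∧
    (∀ b (m k : Idx K),
      lhsXW K V Mo YM a (fun k' => YM b k' cM) m k =
        ∑ j, xwPow K Mo (-(hj j)) (fun kw mx => d j kw mx b) m k) ∧
    (∀ b (m k : Idx K),
      YM (Y a m b) k cM =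
        ∑ j, wxPow K Mo (-(hj j)) (fun kw mx => d j kw mx b) m k)

/-- a and b are dual in the exchange channel on the module -/
def DualExch (Y : V → EDist1 K V) (YM : V → EDist1 K Mo) (a b : V) : Prop :=
  ∃ (r : ℕ) (hab : Fin r → Idx K), (∀ i, Kbar K (hab i)) ∧
    ∀ cM : Mo, ∃ (s : ℕ) (hac : Fin s → Idx K)
      (q : Fin r → Fin s → Idx K → Idx K → Mo),
      (∀ j, Kbar K (hac j)) ∧
      (∀ i j kw mx, q i j kw mx ≠ 0 → IsNegInt K mx.1 ∧ IsNegInt K mx.2) ∧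
      (∀ i j mx, InLat1 K Mo (fun kw => q i j kw mx)) ∧
      (∀ m k : Idx K,
        lhsXW K V Mo YM a (fun k' => YM b k' cM) m k =
          ∑ j, xwPow K Mo (-(hac j))
            (fun kw mx => ∑ i, q i j kw (mx.1 - (hab i).1, mx.2 - (hab i).2)) m k) ∧
      (∀ m k : Idx K,
        YM (Y a m b) k cM =
          ∑ j, wxPow K Mo (-(hac j))
            (fun kw mx => ∑ i, q i j kw (mx.1 - (hab i).1, mx.2 - (hab i).2)) m k)

/-- the module with state-field map YM is dual -/
def IsDualMod (ev od : Submodule K V) (Y : V → EDist1 K V) (YM : V → EDist1 K Mo) : Prop :=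
  ∃ (rVV : V → V → ℕ) (hVV : ∀ a b : V, Fin (rVV a b) → Idx K)
    (rVM : V → Mo → ℕ) (hVM : ∀ (a : V) (c : Mo), Fin (rVM a c) → Idx K),
    (∀ a b i, Kbar K (hVV a b i)) ∧ (∀ a c j, Kbar K (hVM a c j)) ∧
    ∀ a b pa pb, memPar K ev od a pa → memPar K ev od b pb → ∀ c : Mo,
      ∃ p : Fin (rVV a b) → Fin (rVM a c) → Fin (rVM b c) → Dist2 K Mo,
        (∀ i j k, IsPow2 K Mo (p i j k)) ∧
        (∀ m k : Idx K,
          lhsXW K V Mo YM a (fun k' => YM b k' c) m k =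
            ∑ i, ∑ j, ∑ kk, tripleXW K Mo (-(hVV a b i)) (-(hVM b c kk))
              (-(hVM a c j)) (p i j kk) m k) ∧
        (∀ m k : Idx K,
          YM (Y a m b) k c =
            ∑ i, ∑ j, ∑ kk, tripleWX K Mo (-(hVV a b i)) (-(hVM b c kk))
              (-(hVM a c j)) (p i j kk) m k)

/-- F_Y is multiply local -/
def MultLocalAlg (A : OPEAlg K V) : Prop :=
  ∀ (r : ℕ) (f : Fin r → V) (pf : Fin r → ZMod 2),
    (∀ i, memPar K A.ev A.od (f i) (pf i)) →
      MultiplyLocal K V (fun i => A.Y (f i)) pf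

/-- F_Y is uniformly local -/
def UnifLocalAlg (A : OPEAlg K V) : Prop :=
  ∃ (rr : V → V → ℕ) (hh : ∀ a b : V, Fin (rr a b) → Idx K),
    ∀ (r : ℕ) (f : Fin r → V) (pf : Fin r → ZMod 2),
      (∀ i, memPar K A.ev A.od (f i) (pf i)) →
        ∃ c, IsMultOPE K V (fun i => A.Y (f i)) pf (fun i j => rr (f i) (f j))
            (fun i j => hh (f i) (f j)) c ∧
          ∀ α, IsPowN K V (evN K V (c α) A.one)

end OPEA
namespace OPEA

section Binomial

variable {K : Type*} [Field K] [CharZero K]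

theorem gchoose_eq_ringChoose (x : K) (k : ℕ) : gchoose K x k = Ring.choose x k := by
  rw [Ring.choose_eq_smul, gchoose, div_eq_inv_mul, smul_eq_mul]
  congr 1
  induction k with
  | zero => simp
  | succ k ih =>
    rw [Finset.prod_range_succ, ih, descPochhammer_succ_right, Polynomial.smeval_mul,
      Polynomial.smeval_sub, Polynomial.smeval_X, Polynomial.smeval_natCast]
    simp

@[simp] theorem gchoose_zero (x : K) : gchoose K x 0 = 1 := by simp [gchoose]

theorem gchoose_succ (x : K) (k : ℕ) :
    gchoose K x (k + 1) = gchoose K (x - 1) (k + 1) + gchoose K (x - 1) k := by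
  simp only [gchoose_eq_ringChoose]
  have := Ring.choose_succ_succ (x - 1) k
  rw [sub_add_cancel] at this
  rw [this, add_comm]

theorem succ_mul_gchoose_succ (x : K) (k : ℕ) :
    ((k : K) + 1) * gchoose K x (k + 1) = (x - k) * gchoose K x k := by
  have h1 : (k.factorial : K) ≠ 0 := by exact_mod_cast k.factorial_ne_zero
  have h2 : (k : K) + 1 ≠ 0 := by exact_mod_cast k.succ_ne_zero
  rw [gchoose, gchoose, Finset.prod_range_succ, Nat.factorial_succ]
  push_cast
  field_simp

theorem gchoose_neg (x : K) (k : ℕ) :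
    (-1) ^ k * gchoose K (-x) k = gchoose K (x + k - 1) k := by
  simp only [gchoose_eq_ringChoose]
  rw [Ring.choose_neg, Units.smul_def, Int.negOnePow_def, zsmul_eq_mul, ← mul_assoc]
  simp [← mul_pow]

theorem gchoose_natCast (n k : ℕ) : gchoose K (n : K) k = n.choose k := by
  rw [gchoose_eq_ringChoose, Ring.choose_natCast]

theorem gchoose_add (x y : K) (k : ℕ) :
    gchoose K (x + y) k =
      ∑ ij ∈ Finset.HasAntidiagonal.antidiagonal k, gchoose K x ij.1 * gchoose K y ij.2 := by
  simp only [gchoose_eq_ringChoose]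
  exact Ring.add_choose_eq k (Commute.all x y)

/-- The binomial coefficient `C(x, y)` for `y : K`, equal to zero unless `y` is a natural
number. -/
def genChoose (x y : K) : K :=
  if h : ∃ j : ℕ, (j : K) = y then gchoose K x h.choose else 0

@[simp] theorem genChoose_natCast (x : K) (j : ℕ) : genChoose x (j : K) = gchoose K x j := by
  have h : ∃ i : ℕ, (i : K) = (j : K) := ⟨j, rfl⟩
  rw [genChoose, dif_pos h, Nat.cast_injective h.choose_spec]

omit [CharZero K] in
theorem genChoose_of_not {x y : K} (h : ¬ ∃ j : ℕ, (j : K) = y) : genChoose x y = 0 :=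
  dif_neg h

theorem genChoose_neg_succ (x : K) (j : ℕ) : genChoose x (-((j : K) + 1)) = 0 := by
  apply genChoose_of_not
  rintro ⟨i, hi⟩
  have : ((i + j + 1 : ℕ) : K) = 0 := by push_cast; rw [hi]; ring
  exact absurd (Nat.cast_eq_zero.mp this) (by omega)

theorem genChoose_pascal (x y : K) :
    genChoose x y = genChoose (x - 1) y + genChoose (x - 1) (y - 1) := by
  by_cases h : ∃ j : ℕ, (j : K) = y
  · obtain ⟨j, rfl⟩ := h
    cases j with
    | zero =>
      have := genChoose_neg_succ (x - 1) 0
      simp only [Nat.cast_zero, zero_add] at this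
      rw [Nat.cast_zero, zero_sub, this, ← Nat.cast_zero, genChoose_natCast, genChoose_natCast]
      simp
    | succ j =>
      rw [show ((j + 1 : ℕ) : K) - 1 = (j : K) by push_cast; ring]
      simp only [genChoose_natCast]
      exact gchoose_succ x j
  · rw [genChoose_of_not h, genChoose_of_not h, genChoose_of_not, add_zero]
    rintro ⟨j, hj⟩
    exact h ⟨j + 1, by push_cast; rw [hj]; ring⟩

theorem succ_mul_genChoose (x y : K) :
    (y + 1) * genChoose (x + 1) (y + 1) = (x + 1) * genChoose x y := by
  by_cases h : ∃ j : ℕ, (j : K) = y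
  · obtain ⟨j, rfl⟩ := h
    have e : (j : K) + 1 = ((j + 1 : ℕ) : K) := by push_cast; ring
    have h1 := succ_mul_gchoose_succ (x + 1) j
    have h2 := succ_mul_gchoose_succ x j
    have h3 := gchoose_succ (x + 1) j
    rw [add_sub_cancel_right] at h3
    rw [e, genChoose_natCast, genChoose_natCast, ← e, h3]
    linear_combination h2
  · rw [genChoose_of_not h, mul_zero]
    by_cases hy : y + 1 = 0
    · rw [hy, zero_mul]
    · rw [genChoose_of_not, mul_zero]
      rintro ⟨j, hj⟩
      cases j with
      | zero => exact hy (by rw [← hj]; simp)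
      | succ j => exact h ⟨j, by push_cast at hj; exact add_right_cancel hj⟩

theorem mul_genChoose_pred (x y : K) :
    x * genChoose (x - 1) y = (x - y) * genChoose x y := by
  have h1 := genChoose_pascal x y
  have h2 := succ_mul_genChoose (x - 1) (y - 1)
  simp only [sub_add_cancel] at h2
  linear_combination (-x) * h1 + h2

/-- The rational function identity relating the expansions around the three points
`z = w`, `w = 0` and `z = 0`. -/
theorem genChoose_residue (p q : ℤ) :
    genChoose (-(p : K) - 1) (-(p : K) - q - 1) =
      genChoose (-(p : K) - 1) q - (-1) ^ (p + q) * genChoose (-(q : K) - 1) p := by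
  have key : ∀ i j : ℕ, gchoose K (-(i : K) - 1) j = (-1) ^ j * ((i + j).choose j : K) := by
    intro i j
    have := gchoose_neg ((i : K) + 1) j
    rw [show ((i : K) + 1 + j - 1) = ((i + j : ℕ) : K) by push_cast; ring, gchoose_natCast] at this
    rw [← this, ← mul_assoc, ← mul_pow, show -(i : K) - 1 = -((i : K) + 1) by ring]
    simp
  rcases Int.eq_ofNat_of_zero_le (a := p) |> fun h => (lt_or_ge p 0).imp_right h with hp | ⟨p, rfl⟩
  · obtain ⟨a, rfl⟩ : ∃ a : ℕ, p = -(a : ℤ) - 1 := ⟨(-p - 1).toNat, by omega⟩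
    have h0 : genChoose (-(q : K) - 1) ((-(a : ℤ) - 1 : ℤ) : K) = 0 := by
      have := genChoose_neg_succ (-(q : K) - 1) a
      rw [← this]; congr 1; push_cast; ring
    rw [h0, mul_zero, sub_zero]
    have e1 : -((-(a : ℤ) - 1 : ℤ) : K) - 1 = (a : K) := by push_cast; ring
    have e2 : -((-(a : ℤ) - 1 : ℤ) : K) - (q : K) - 1 = ((a - q : ℤ) : K) := by push_cast; ring
    rw [e1, e2]
    rcases lt_or_ge q 0 with hq | hq
    · obtain ⟨b, rfl⟩ : ∃ b : ℕ, q = -(b : ℤ) - 1 := ⟨(-q - 1).toNat, by omega⟩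
      have h0 : genChoose (a : K) ((-(b : ℤ) - 1 : ℤ) : K) = 0 := by
        have := genChoose_neg_succ (a : K) b
        rw [← this]; congr 1; push_cast; ring
      rw [h0, show ((a : ℤ) - (-(b : ℤ) - 1)) = ((a + b + 1 : ℕ) : ℤ) by push_cast; ring,
        Int.cast_natCast, genChoose_natCast, gchoose_natCast, Nat.choose_eq_zero_of_lt (by omega),
        Nat.cast_zero]
    · obtain ⟨b, rfl⟩ := Int.eq_ofNat_of_zero_le hq
      rw [Int.cast_natCast, genChoose_natCast, gchoose_natCast]
      rcases le_or_gt b a with hba | hba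
      · rw [← Nat.cast_sub hba, Int.cast_natCast, genChoose_natCast, gchoose_natCast,
          Nat.choose_symm hba]
      · obtain ⟨c, rfl⟩ : ∃ c, b = a + c + 1 := ⟨b - a - 1, by omega⟩
        have := genChoose_neg_succ (a : K) c
        rw [Nat.choose_eq_zero_of_lt (by omega), Nat.cast_zero, ← this]
        congr 1; push_cast; ring
  · rcases lt_or_ge q 0 with hq | hq
    · obtain ⟨b, rfl⟩ : ∃ b : ℕ, q = -(b : ℤ) - 1 := ⟨(-q - 1).toNat, by omega⟩
      have h0 : genChoose (-((p : ℤ) : K) - 1) ((-(b : ℤ) - 1 : ℤ) : K) = 0 := by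
        have := genChoose_neg_succ (-((p : ℤ) : K) - 1) b
        rw [← this]; congr 1; push_cast; ring
      have e1 : -((-(b : ℤ) - 1 : ℤ) : K) - 1 = (b : K) := by push_cast; ring
      have e2 : -((p : ℤ) : K) - ((-(b : ℤ) - 1 : ℤ) : K) - 1 = ((b - p : ℤ) : K) := by
        push_cast; ring
      rw [h0, e1, e2, Int.cast_natCast, genChoose_natCast, gchoose_natCast]
      rcases le_or_gt p b with hpb | hpb
      · obtain ⟨c, rfl⟩ := Nat.exists_eq_add_of_le hpb
        rw [show ((p + c : ℕ) : ℤ) - p = (c : ℤ) by push_cast; ring, Int.cast_natCast,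
          genChoose_natCast, key, show (p : ℤ) + (-((p + c : ℕ) : ℤ) - 1) = -(c : ℤ) - 1 by
            push_cast; ring, Nat.choose_symm_add]
        rw [show -(c : ℤ) - 1 = -((c + 1 : ℕ) : ℤ) by push_cast; ring, zpow_neg, zpow_natCast,
          pow_succ]
        rcases neg_one_pow_eq_or K c with h | h <;> rw [h] <;> norm_num
      · obtain ⟨c, rfl⟩ : ∃ c, p = b + c + 1 := ⟨p - b - 1, by omega⟩
        have := genChoose_neg_succ (-((b + c + 1 : ℕ) : K) - 1) c
        rw [Nat.choose_eq_zero_of_lt (by omega), Nat.cast_zero, mul_zero, sub_zero, ← this]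
        congr 1; push_cast; ring
    · obtain ⟨q, rfl⟩ := Int.eq_ofNat_of_zero_le hq
      have h0 : genChoose (-(p : K) - 1) (-(p : K) - q - 1) = 0 := by
        rw [show -(p : K) - q - 1 = -(((p + q : ℕ) : K) + 1) by push_cast; ring]
        exact genChoose_neg_succ _ _
      simp only [Int.cast_natCast]
      rw [h0, genChoose_natCast, genChoose_natCast, key, key, ← Nat.cast_add, zpow_natCast,
        pow_add, add_comm q p, Nat.choose_symm_add]
      rcases neg_one_pow_eq_or K p with h | h <;> rw [h] <;> ring

end Binomial

section IntegerClasses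

variable {K : Type*} [Field K]

theorem IsInt.intCast (k : ℤ) : IsInt K (k : K) := ⟨k, rfl⟩

theorem IsInt.add {x y : K} (hx : IsInt K x) (hy : IsInt K y) : IsInt K (x + y) := by
  obtain ⟨k, rfl⟩ := hx
  obtain ⟨l, rfl⟩ := hy
  exact ⟨k + l, by push_cast; rfl⟩

theorem IsInt.neg {x : K} (hx : IsInt K x) : IsInt K (-x) := by
  obtain ⟨k, rfl⟩ := hx
  exact ⟨-k, by push_cast; rfl⟩

theorem IsInt.sub {x y : K} (hx : IsInt K x) (hy : IsInt K y) : IsInt K (x - y) := by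
  rw [sub_eq_add_neg]; exact hx.add hy.neg

theorem isInt_one : IsInt K (1 : K) := ⟨1, by simp⟩

theorem isInt_sub_one_iff {x : K} : IsInt K (x - 1) ↔ IsInt K x :=
  ⟨fun h => by simpa using h.add isInt_one, fun h => h.sub isInt_one⟩

/-- A chosen representative of the class of `x` modulo the integers. -/
def intRep (x : K) : K :=
  (QuotientAddGroup.mk x : K ⧸ (Int.castAddHom K).range).out

theorem isInt_sub_intRep (x : K) : IsInt K (x - intRep x) := by
  have h : (QuotientAddGroup.mk (intRep x) : K ⧸ (Int.castAddHom K).range) =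
      QuotientAddGroup.mk x := Quotient.out_eq _
  obtain ⟨k, hk⟩ := QuotientAddGroup.eq.mp h
  have hk' : (k : K) = -intRep x + x := hk
  exact ⟨k, by rw [hk']; ring⟩

theorem intRep_eq_of_isInt {x y : K} (h : IsInt K (x - y)) : intRep x = intRep y := by
  obtain ⟨k, hk⟩ := h
  unfold intRep
  congr 1
  refine QuotientAddGroup.eq.mpr ⟨-k, ?_⟩
  change ((-k : ℤ) : K) = -x + y
  rw [Int.cast_neg, hk]
  ring

theorem exists_natAbs_bound [CharZero K] {ι : Type*} (S : Finset ι) (u : ι → K) :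
    ∃ N : ℕ, ∀ p ∈ S, ∀ k : ℤ, (k : K) = u p → k.natAbs ≤ N := by
  induction S using Finset.induction_on with
  | empty => exact ⟨0, by simp⟩
  | insert a S ha ih =>
    obtain ⟨N, hN⟩ := ih
    by_cases h : ∃ k : ℤ, (k : K) = u a
    · obtain ⟨k, hk⟩ := h
      refine ⟨max N k.natAbs, fun p hp l hl => ?_⟩
      rcases Finset.mem_insert.mp hp with rfl | hp
      · rw [Int.cast_injective (hl.trans hk.symm)]; exact le_max_right _ _
      · exact (hN p hp l hl).trans (le_max_left _ _)
    · refine ⟨N, fun p hp l hl => ?_⟩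
      rcases Finset.mem_insert.mp hp with rfl | hp
      · exact absurd ⟨l, hl⟩ h
      · exact hN p hp l hl

theorem negOnePow_intCast [CharZero K] (k : ℤ) : negOnePow K (k : K) = (-1) ^ k := by
  have h : ∃ i : ℤ, (i : K) = (k : K) := ⟨k, rfl⟩
  rw [negOnePow, dif_pos h, Int.cast_injective h.choose_spec]

/-- The sign of the distance of `x` to the representative of its class modulo the integers. -/
def classSign (x : K) : K := negOnePow K (x - intRep x)

theorem classSign_mul_classSign [CharZero K] {x y : K} (h : IsInt K (x - y)) :
    classSign x * classSign y = negOnePow K (x - y) := by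
  have e := intRep_eq_of_isInt h
  obtain ⟨k, hk⟩ := isInt_sub_intRep x
  obtain ⟨l, hl⟩ := isInt_sub_intRep y
  have : x - y = ((k - l : ℤ) : K) := by push_cast; rw [hk, hl, e]; ring
  rw [classSign, classSign, ← hk, ← hl, this]
  simp only [negOnePow_intCast]
  rw [zpow_sub₀ (by simp), div_eq_mul_inv, ← zpow_neg]
  congr 1
  rw [zpow_neg, ← inv_zpow, inv_neg, inv_one]

theorem classSign_mul_self [CharZero K] (x : K) : classSign x * classSign x = 1 := by
  rw [classSign_mul_classSign (by rw [sub_self]; exact ⟨0, by simp⟩), sub_self]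
  have := negOnePow_intCast (K := K) 0
  simpa using this

theorem classSign_sub_one [CharZero K] (x : K) : classSign (x - 1) = -classSign x := by
  have e : intRep (x - 1) = intRep x :=
    intRep_eq_of_isInt (by rw [sub_sub_cancel_left]; exact isInt_one.neg)
  obtain ⟨k, hk⟩ := isInt_sub_intRep x
  have : x - 1 - intRep x = ((k - 1 : ℤ) : K) := by push_cast; rw [hk]; ring
  rw [classSign, classSign, e, this, ← hk, negOnePow_intCast, negOnePow_intCast,
    zpow_sub₀ (by simp), zpow_one, div_neg, div_one]

end IntegerClasses

section CoefficientFunctions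

variable {K : Type*} [Field K]

/-- Functions of `(y, h)` which are compatible with the relation `z - w = (z - w)` between
the symbols `z ^ x * w ^ y * (z - w) ^ (-h)` of fixed total degree. -/
def IsRel (f : K → K → K) : Prop := ∀ y h, f y h = f (y - 1) h + f y (h - 1)

/-- The coefficient at `w`-index `Y` of the expansion in `z > w` of the symbol `(y, h)`. -/
def iota (Y y h : K) : K := genChoose (h + (y - Y) - 1) (y - Y)

/-- The exchange of the two variables. -/
def exch (M : K) : (K → K → K) →ₗ[K] (K → K → K) where
  toFun f y h := classSign h * f (M - y - h) h
  map_add' f g := by funext y h; simp [mul_add]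
  map_smul' c f := by funext y h; simp [mul_left_comm]

/-- The coefficient at `z`-index `X` of the expansion in `w > z` of the symbol `(y, h)`. -/
def kappa (M X : K) : K → K → K := exch M (iota X)

/-- The coefficient of the expansion of the symbol `(y, h)` in powers of `z - w` and `w` that
enters the `n`-th product. -/
def phi (n M y h : K) : K := genChoose (y + h - M - 1) (h - 1 - n)

theorem exch_apply (M : K) (f : K → K → K) (y h : K) :
    exch M f y h = classSign h * f (M - y - h) h := rfl

theorem kappa_apply (M X y h : K) : kappa M X y h = classSign h * iota X (M - y - h) h := rfl

theorem iota_eq_zero {Y y h : K} (hy : ¬ IsInt K (y - Y)) : iota Y y h = 0 :=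
  genChoose_of_not fun ⟨j, hj⟩ => hy ⟨j, by simpa using hj⟩

theorem iota_sub_natCast [CharZero K] (Y h : K) (s : ℕ) :
    iota (Y - s) Y h = gchoose K (h + s - 1) s := by
  rw [iota, sub_sub_cancel, genChoose_natCast]

theorem IsRel.ite {f : K → K → K} (hf : IsRel f) {C : K → K → Prop}
    [∀ y h, Decidable (C y h)] (h1 : ∀ y h, C (y - 1) h ↔ C y h) (h2 : ∀ y h, C y (h - 1) ↔ C y h) :
    IsRel fun y h => if C y h then f y h else 0 := by
  intro y h
  simp only [h1, h2]
  split_ifs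
  · exact hf y h
  · simp

variable [CharZero K]

theorem isRel_iota (Y : K) : IsRel (iota Y) := by
  intro y h
  have := genChoose_pascal (h + (y - Y) - 1) (y - Y)
  simp only [iota]
  rw [this, add_comm]
  congr 2 <;> ring

theorem isRel_phi (n M : K) : IsRel (phi n M) := by
  intro y h
  have := genChoose_pascal (y + h - M - 1) (h - 1 - n)
  simp only [phi]
  rw [this]
  congr 2 <;> ring

theorem IsRel.exch {f : K → K → K} (hf : IsRel f) (M : K) : IsRel (exch M f) := by
  intro y h
  simp only [exch_apply]
  have := hf (M - (y - 1) - h) h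
  rw [show M - (y - 1) - h - 1 = M - y - h by ring] at this
  rw [classSign_sub_one, show M - y - (h - 1) = M - (y - 1) - h by ring, this]
  ring

theorem exch_exch (M : K) (f : K → K → K) : exch M (exch M f) = f := by
  funext y h
  rw [exch_apply, exch_apply, ← mul_assoc, classSign_mul_self, one_mul]
  congr 1
  ring

theorem isRel_kappa (M X : K) : IsRel (kappa M X) := (isRel_iota X).exch M

omit [CharZero K] in
theorem IsRel.of_mem_span {B : Set (K → K → K)} (hB : ∀ f ∈ B, IsRel f) {g : K → K → K}
    (hg : g ∈ Submodule.span K B) : IsRel g := by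
  induction hg using Submodule.span_induction with
  | mem f hf => exact hB f hf
  | zero => intro y h; simp
  | add f g _ _ hf hg =>
    intro y h
    simp only [Pi.add_apply]
    rw [hf y h, hg y h]
    ring
  | smul c f _ hf =>
    intro y h
    simp only [Pi.smul_apply, smul_eq_mul]
    rw [hf y h]
    ring

theorem exists_span_iota_interpolate (Y : K) (u : K → K) (H : Finset K) :
    ∃ g ∈ Submodule.span K (Set.range fun s : ℕ => iota (Y - s)), ∀ h ∈ H, g Y h = u h := by
  set W : Submodule K (K → K) := (Submodule.span K (Set.range fun s : ℕ => iota (Y - s))).map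
    (LinearMap.proj (φ := fun _ : K => K → K) Y) with hW
  have hWs : W = Submodule.span K (Set.range fun (s : ℕ) (h : K) => gchoose K (h + s - 1) s) := by
    rw [hW, Submodule.map_span, ← Set.range_comp]
    congr 2
    funext s h
    exact iota_sub_natCast Y h s
  have hmul : ∀ w ∈ W, (fun h => h * w h) ∈ W := by
    rw [hWs]
    intro w hw
    induction hw using Submodule.span_induction with
    | mem w hw =>
      obtain ⟨s, rfl⟩ := hw
      have e : (fun h : K => h * gchoose K (h + s - 1) s) =
          ((s : K) + 1) • (fun h => gchoose K (h + (s + 1 : ℕ) - 1) (s + 1)) -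
            (s : K) • (fun h => gchoose K (h + s - 1) s) := by
        funext h
        have h1 := succ_mul_gchoose_succ (h + s) s
        have h2 := succ_mul_genChoose (h + s - 1) s
        have e : (s : K) + 1 = ((s + 1 : ℕ) : K) := by push_cast; ring
        rw [e, genChoose_natCast, genChoose_natCast, ← e] at h2
        simp only [Pi.sub_apply, Pi.smul_apply, smul_eq_mul]
        rw [show h + ((s + 1 : ℕ) : K) - 1 = h + s - 1 + 1 by push_cast; ring, h2]
        ring
      rw [e]
      exact Submodule.sub_mem _
        (Submodule.smul_mem _ _ (Submodule.subset_span ⟨s + 1, rfl⟩))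
        (Submodule.smul_mem _ _ (Submodule.subset_span ⟨s, rfl⟩))
    | zero =>
      convert Submodule.zero_mem _ using 1
      funext h; simp
    | add f g _ _ hf hg =>
      convert Submodule.add_mem _ hf hg using 1
      funext h; simp [mul_add]
    | smul c f _ hf =>
      convert Submodule.smul_mem _ c hf using 1
      funext h; simp [mul_left_comm]
  have hone : (fun _ => 1) ∈ W := by
    rw [hWs]
    refine Submodule.subset_span ⟨0, ?_⟩
    funext h; simp
  have hpow : ∀ n : ℕ, (fun h : K => h ^ n) ∈ W := by
    intro n
    induction n with
    | zero => simpa using hone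
    | succ n ih =>
      convert hmul _ ih using 1
      funext h; rw [pow_succ']
  have hpoly : ∀ p : Polynomial K, (fun h => p.eval h) ∈ W := by
    intro p
    induction p using Polynomial.induction_on' with
    | add p q hp hq =>
      convert Submodule.add_mem _ hp hq using 1
      funext h; simp
    | monomial n a =>
      convert Submodule.smul_mem _ a (hpow n) using 1
      funext h; simp
  obtain ⟨g, hg, hgp⟩ := Submodule.mem_map.mp (hpoly (Lagrange.interpolate H id u))
  refine ⟨g, hg, fun h hh => ?_⟩
  rw [show g Y h = _ from congrFun hgp h]
  exact Lagrange.eval_interpolate_at_node u (Set.injOn_id _) hh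

theorem exists_span_iota_of_class {f : K → K → K} (hf : IsRel f) (r : K)
    (hfr : ∀ y h, ¬ IsInt K (y - r) → f y h = 0) (S : Finset (K × K)) :
    ∃ g ∈ Submodule.span K (iota '' {Y | IsInt K (Y - r)}),
      ∀ y h, (y, h) ∈ S ∨ ¬ IsInt K (y - r) → f y h = g y h := by
  obtain ⟨N, hN⟩ := exists_natAbs_bound S fun p => p.1 - r
  set H : Finset K := (S ×ˢ Finset.range (2 * N + 1)).image fun q => q.1.2 - (q.2 : K)
  set Y : K := r + N
  obtain ⟨g, hg, hgY⟩ := exists_span_iota_interpolate Y (f Y) H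
  have hsub : (Set.range fun s : ℕ => iota (Y - s)) ⊆ iota '' {Y | IsInt K (Y - r)} := by
    rintro _ ⟨s, rfl⟩
    refine ⟨Y - s, ⟨N - s, ?_⟩, rfl⟩
    push_cast; ring
  have hg' := Submodule.span_mono hsub hg
  have hrel : IsRel g := IsRel.of_mem_span (by rintro _ ⟨Y, _, rfl⟩; exact isRel_iota Y) hg'
  have hsupp : ∀ y h, ¬ IsInt K (y - r) → g y h = 0 := by
    intro y h hy
    clear hrel hgY hg
    induction hg' using Submodule.span_induction with
    | mem w hw =>
      obtain ⟨Y', hY', rfl⟩ := hw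
      refine iota_eq_zero fun hi => hy ?_
      simpa using hi.add hY'
    | zero => rfl
    | add f g _ _ hf hg => simp [hf, hg]
    | smul c f _ hf => simp [hf]
  have hind : ∀ (l : ℕ) (h : K), (∀ i ≤ l, h - (i : K) ∈ H) → f (Y - l) h = g (Y - l) h := by
    intro l
    induction l with
    | zero =>
      intro h hh
      have := hh 0 le_rfl
      simp only [Nat.cast_zero, sub_zero] at this ⊢
      exact (hgY h this).symm
    | succ l ih =>
      intro h hh
      have h1 := ih h fun i hi => hh i (by omega)
      have h2 := ih (h - 1) fun i hi => by
        have := hh (i + 1) (by omega)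
        rwa [Nat.cast_add, Nat.cast_one, add_comm, ← sub_sub] at this
      have h3 := hf (Y - l) h
      have h4 := hrel (Y - l) h
      rw [show Y - ((l + 1 : ℕ) : K) = Y - l - 1 by push_cast; ring]
      linear_combination h1 - h2 - h3 + h4
  refine ⟨g, hg', fun y h hyh => ?_⟩
  by_cases hy : IsInt K (y - r)
  · have hyS : (y, h) ∈ S := hyh.resolve_right (not_not_intro hy)
    obtain ⟨k, hk⟩ := hy
    have hkN := hN _ hyS k hk
    obtain ⟨l, hl⟩ : ∃ l : ℕ, (l : ℤ) = N - k := ⟨(N - k).toNat, by omega⟩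
    have e : y = Y - l := by
      have : ((l : ℤ) : K) = ((N - k : ℤ) : K) := by rw [hl]
      push_cast at this
      rw [this, hk]
      simp only [Y]; ring
    rw [e]
    refine hind l h fun i hi => ?_
    refine Finset.mem_image.mpr ⟨((y, h), i), ?_, rfl⟩
    simp only [Finset.mem_product, Finset.mem_range]
    exact ⟨hyS, by omega⟩
  · rw [hfr y h hy, hsupp y h hy]

/-- On a finite set, every function compatible with the symbol relations is a combination of
coefficients of the expansion in `z > w`. -/
theorem exists_span_iota {f : K → K → K} (hf : IsRel f) {C : K → Prop}
    (hC : ∀ x y, IsInt K (x - y) → C x → C y) (hfC : ∀ y h, ¬ C y → f y h = 0)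
    (S : Finset (K × K)) :
    ∃ g ∈ Submodule.span K (iota '' {Y | C Y}), ∀ y h, (y, h) ∈ S → f y h = g y h := by
  have hpiece : ∀ r : K, ∃ g ∈ Submodule.span K (iota '' {Y | C Y}), ∀ y h, (y, h) ∈ S →
      (if intRep y = r then f y h else 0) = g y h := by
    intro r
    have hinv : ∀ y : K, intRep (y - 1) = intRep y := fun y =>
      intRep_eq_of_isInt (by rw [sub_sub_cancel_left]; exact isInt_one.neg)
    obtain ⟨g, hg, hgS⟩ := exists_span_iota_of_class
      (f := fun y h => if intRep y = r then f y h else 0)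
      (hf.ite (C := fun y _ => intRep y = r) (fun y h => by rw [hinv]) (fun y h => Iff.rfl)) r
      (by
        intro y h hy
        refine if_neg ?_
        rintro rfl
        exact hy (isInt_sub_intRep y)) S
    by_cases hr : C r
    · refine ⟨g, Submodule.span_mono (Set.image_mono fun Y hY => ?_) hg, fun y h hyh =>
        hgS y h (Or.inl hyh)⟩
      exact hC r Y (by simpa using IsInt.neg hY) hr
    · refine ⟨0, Submodule.zero_mem _, fun y h _ => ?_⟩
      split_ifs with hy
      · refine hfC y h fun hCy => hr (hC y r ?_ hCy)
        rw [← hy]; exact isInt_sub_intRep y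
      · rfl
  choose g hg hgS using hpiece
  refine ⟨∑ r ∈ S.image fun p => intRep p.1, g r, Submodule.sum_mem _ fun r _ => hg r,
    fun y h hyh => ?_⟩
  rw [Finset.sum_apply, Finset.sum_apply, ← Finset.sum_congr rfl fun r _ => hgS r y h hyh,
    Finset.sum_ite_eq, if_pos (Finset.mem_image.mpr ⟨(y, h), hyh, rfl⟩)]

/-- On a finite set, every function compatible with the symbol relations is a combination of
coefficients of the expansion in `w > z`. -/
theorem exists_span_kappa {f : K → K → K} (hf : IsRel f) (M : K) {C : K → Prop}
    (hC : ∀ x y, IsInt K (x - y) → C x → C y) (hfC : ∀ y h, ¬ C (M - y - h) → f y h = 0)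
    (S : Finset (K × K)) :
    ∃ g ∈ Submodule.span K (kappa M '' {X | C X}), ∀ y h, (y, h) ∈ S → f y h = g y h := by
  obtain ⟨g, hg, hgS⟩ := exists_span_iota (hf.exch M) hC
    (fun y h hy => by
      rw [exch_apply, hfC, mul_zero]
      rwa [show M - (M - y - h) - h = y by ring])
    (S.image fun p => (M - p.1 - p.2, p.2))
  refine ⟨exch M g, ?_, fun y h hyh => ?_⟩
  · have := Submodule.mem_map_of_mem (f := exch M) hg
    rwa [Submodule.map_span, Set.image_image] at this
  · have := hgS (M - y - h) h (Finset.mem_image.mpr ⟨(y, h), hyh, rfl⟩)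
    rw [exch_apply, ← this, ← exch_apply, exch_exch]

theorem sum_iota_eq (n m : K) (q : ℤ) (h : K) (J : ℕ) (hJ : q < J) :
    ∑ j ∈ Finset.range J, (-1) ^ j * gchoose K n j * iota (m + j) (m + q) h =
      genChoose (h - n + q - 1) q := by
  rcases lt_or_ge q 0 with hq | hq
  · have hz : ∀ (x : K) (j : ℕ), genChoose x ((q : K) - j) = 0 := by
      intro x j
      obtain ⟨b, hb⟩ : ∃ b : ℕ, (b : ℤ) = j - q - 1 := ⟨(j - q - 1).toNat, by omega⟩
      have hb' : (b : K) = j - q - 1 := by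
        have : ((b : ℤ) : K) = ((j - q - 1 : ℤ) : K) := by rw [hb]
        push_cast at this; exact this
      rw [← genChoose_neg_succ x b, hb']
      congr 1; ring
    have := hz (h - n + q - 1) 0
    rw [Nat.cast_zero, sub_zero] at this
    rw [this]
    refine Finset.sum_eq_zero fun j _ => ?_
    rw [iota, show m + (q : K) - (m + j) = q - j by ring, hz, mul_zero]
  · obtain ⟨q, rfl⟩ := Int.eq_ofNat_of_zero_le hq
    have hJ' : q + 1 ≤ J := by omega
    have hiota : ∀ i j : ℕ, iota (m + i) (m + ((i + j : ℕ) : K)) h =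
        (-1) ^ j * gchoose K (-h) j := by
      intro i j
      rw [gchoose_neg, iota, show m + ((i + j : ℕ) : K) - (m + i) = (j : K) by push_cast; ring,
        genChoose_natCast]
    simp only [Int.cast_natCast]
    rw [genChoose_natCast, ← gchoose_neg, neg_sub, sub_eq_add_neg, gchoose_add, Finset.mul_sum,
      ← Finset.sum_subset (Finset.range_mono hJ'), Finset.Nat.sum_antidiagonal_eq_sum_range_succ_mk]
    · refine Finset.sum_congr rfl fun i hi => ?_
      obtain ⟨j, rfl⟩ := Nat.exists_eq_add_of_le (Nat.lt_succ_iff.mp (Finset.mem_range.mp hi))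
      rw [hiota, Nat.add_sub_cancel_left, pow_add]
      ring
    · intro i _ hi
      obtain ⟨b, rfl⟩ : ∃ b, i = q + b + 1 := ⟨i - q - 1, by
        have := Finset.mem_range.not.mp hi; omega⟩
      rw [iota, show m + (q : K) - (m + ((q + b + 1 : ℕ) : K)) = -((b : K) + 1) by
        push_cast; ring, genChoose_neg_succ, mul_zero]

/-- The residue at `z = w` is the difference of the residues of the two expansions. -/
theorem exists_phi_eq_sum (n : K) (m : ℤ) (S : Finset (K × K)) :
    ∃ J : ℕ, ∀ y h, (y, h) ∈ S → IsInt K y → IsInt K (m + n - y - h) →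
      phi n (m + n) y h =
        ∑ j ∈ Finset.range (J + 1), (-1) ^ j * gchoose K n j * iota ((m : K) + j) y h -
        classSign n * ∑ j ∈ Finset.range (J + 1),
          (-1) ^ j * gchoose K n j * kappa ((m : K) + n) j y h := by
  obtain ⟨N₁, hN₁⟩ := exists_natAbs_bound S fun p => p.1 - (m : K)
  obtain ⟨N₂, hN₂⟩ := exists_natAbs_bound S fun p => (m : K) + n - p.1 - p.2
  refine ⟨N₁ + N₂, fun y h hyh hy hx => ?_⟩
  obtain ⟨q, hq⟩ := hy.sub (IsInt.intCast (K := K) m)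
  obtain ⟨p, hp⟩ := hx
  have hq' := hN₁ _ hyh q hq
  have hp' := hN₂ _ hyh p hp
  have hyq : y = m + q := by rw [hq]; ring
  have hnh : n - h = ((p + q : ℤ) : K) := by push_cast; rw [hp, hq]; ring
  have hsgn : classSign n * classSign h = (-1 : K) ^ (p + q) := by
    rw [classSign_mul_classSign ⟨_, hnh.symm⟩, hnh, negOnePow_intCast]
  have h1 := sum_iota_eq n m q h (N₁ + N₂ + 1) (by omega)
  have h2 := sum_iota_eq n 0 p h (N₁ + N₂ + 1) (by omega)
  rw [← hyq] at h1
  simp only [zero_add] at h2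
  have h3 : ∑ j ∈ Finset.range (N₁ + N₂ + 1),
      (-1) ^ j * gchoose K n j * kappa ((m : K) + n) j y h =
      classSign h * genChoose (h - n + p - 1) p := by
    rw [← h2, Finset.mul_sum]
    refine Finset.sum_congr rfl fun j _ => ?_
    rw [kappa_apply, ← hp]
    ring
  have hr := genChoose_residue (K := K) p q
  have hh : h = n - p - q := by push_cast at hnh; linear_combination -hnh
  rw [h1, h3, ← mul_assoc, hsgn, phi]
  rw [show y + h - (m + n) - 1 = -(p : K) - 1 by rw [hyq, hh]; ring,
    show h - 1 - n = -(p : K) - q - 1 by rw [hh]; ring,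
    show h - n + q - 1 = -(p : K) - 1 by rw [hh]; ring,
    show h - n + p - 1 = -(q : K) - 1 by rw [hh]; ring]
  exact hr

end CoefficientFunctions

section FiniteDependence

variable {K : Type*} [Field K] {G : Type*} [AddCommGroup G] [Module K G]

/-- A linear map on coefficient functions that factors through the restriction to a finite set. -/
def FactorsFinite (l : (K → K → K) →ₗ[K] G) : Prop :=
  ∃ S : Finset (K × K), ∀ f, (∀ y h, (y, h) ∈ S → f y h = 0) → l f = 0

variable {l : (K → K → K) →ₗ[K] G}

theorem eq_zero_of_mem_span {B : Set (K → K → K)} (hB : ∀ f ∈ B, l f = 0) {g : K → K → K}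
    (hg : g ∈ Submodule.span K B) : l g = 0 :=
  (Submodule.span_le.mpr hB : Submodule.span K B ≤ LinearMap.ker l) hg

variable [CharZero K]

theorem FactorsFinite.eq_zero_of_iota (hl : FactorsFinite l) {C : K → Prop}
    (hC : ∀ x y, IsInt K (x - y) → C x → C y) (h0 : ∀ Y, C Y → l (iota Y) = 0)
    {f : K → K → K} (hf : IsRel f) (hfC : ∀ y h, ¬ C y → f y h = 0) : l f = 0 := by
  obtain ⟨S, hS⟩ := hl
  obtain ⟨g, hg, hgS⟩ := exists_span_iota hf hC hfC S
  have hz : l (f - g) = 0 := hS _ fun y h hyh => sub_eq_zero.mpr (hgS y h hyh)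
  rw [map_sub, eq_zero_of_mem_span _ hg, sub_zero] at hz
  · exact hz
  · rintro _ ⟨Y, hY, rfl⟩
    exact h0 Y hY

theorem FactorsFinite.eq_zero_of_kappa (hl : FactorsFinite l) (M : K) {C : K → Prop}
    (hC : ∀ x y, IsInt K (x - y) → C x → C y) (h0 : ∀ X, C X → l (kappa M X) = 0)
    {f : K → K → K} (hf : IsRel f) (hfC : ∀ y h, ¬ C (M - y - h) → f y h = 0) : l f = 0 := by
  obtain ⟨S, hS⟩ := hl
  obtain ⟨g, hg, hgS⟩ := exists_span_kappa hf M hC hfC S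
  have hz : l (f - g) = 0 := hS _ fun y h hyh => sub_eq_zero.mpr (hgS y h hyh)
  rw [map_sub, eq_zero_of_mem_span _ hg, sub_zero] at hz
  · exact hz
  · rintro _ ⟨Y, hY, rfl⟩
    exact h0 Y hY

theorem FactorsFinite.eq_zero_of_forall_iota (hl : FactorsFinite l)
    (h0 : ∀ Y, l (iota Y) = 0) {f : K → K → K} (hf : IsRel f) : l f = 0 :=
  hl.eq_zero_of_iota (C := fun _ => True) (fun _ _ _ => id) (fun Y _ => h0 Y) hf
    fun _ _ h => absurd trivial h

theorem FactorsFinite.eq_zero_of_forall_kappa (hl : FactorsFinite l) (M : K)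
    (h0 : ∀ X, l (kappa M X) = 0) {f : K → K → K} (hf : IsRel f) : l f = 0 :=
  hl.eq_zero_of_kappa M (C := fun _ => True) (fun _ _ _ => id) (fun X _ => h0 X) hf
    fun _ _ h => absurd trivial h

omit [CharZero K] in
theorem IsRel.sub {f g : K → K → K} (hf : IsRel f) (hg : IsRel g) : IsRel (f - g) := by
  intro y h
  simp only [Pi.sub_apply]
  rw [hf y h, hg y h]
  ring

/-- If only integral indices contribute to both expansions, then so do only the integral symbols. -/
theorem FactorsFinite.exists_eq_zero_of_integral (hl : FactorsFinite l) (M : K)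
    (hA : ∀ Y, ¬ IsInt K Y → l (iota Y) = 0) (hB : ∀ X, ¬ IsInt K X → l (kappa M X) = 0) :
    ∃ S : Finset (K × K), ∀ f, IsRel f →
      (∀ y h, (y, h) ∈ S → IsInt K y → IsInt K (M - y - h) → f y h = 0) → l f = 0 := by
  have hinv : ∀ x y : K, IsInt K (x - y) → ¬ IsInt K x → ¬ IsInt K y := fun x y hxy hx hy =>
    hx (by simpa using hxy.add hy)
  obtain ⟨S, hS⟩ := id hl
  refine ⟨S, fun f hf hfS => ?_⟩
  have h1 : l (fun y h => if ¬ IsInt K y then f y h else 0) = 0 := by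
    refine hl.eq_zero_of_iota hinv hA (hf.ite (fun y h => ?_) fun y h => Iff.rfl)
      fun y h hy => if_neg hy
    rw [isInt_sub_one_iff]
  have h2 : l (fun y h => if IsInt K y ∧ ¬ IsInt K (M - y - h) then f y h else 0) = 0 := by
    refine hl.eq_zero_of_kappa M hinv hB (hf.ite (fun y h => ?_) fun y h => ?_)
      fun y h hx => if_neg fun hh => hx hh.2
    · rw [isInt_sub_one_iff, ← isInt_sub_one_iff (x := M - (y - 1) - h),
        show M - (y - 1) - h - 1 = M - y - h by ring]
    · rw [← isInt_sub_one_iff (x := M - y - (h - 1)),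
        show M - y - (h - 1) - 1 = M - y - h by ring]
  have h3 : l (fun y h => if IsInt K y ∧ IsInt K (M - y - h) then f y h else 0) = 0 := by
    refine hS _ fun y h hyh => ?_
    split_ifs with hi
    · exact hfS y h hyh hi.1 hi.2
    · rfl
  have hsum : f = (fun y h => if ¬ IsInt K y then f y h else 0) +
      (fun y h => if IsInt K y ∧ ¬ IsInt K (M - y - h) then f y h else 0) +
      (fun y h => if IsInt K y ∧ IsInt K (M - y - h) then f y h else 0) := by
    funext y h
    simp only [Pi.add_apply]
    by_cases hy : IsInt K y <;> by_cases hx : IsInt K (M - y - h) <;> simp [hy, hx]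
  rw [hsum, map_add, map_add, h1, h2, h3, add_zero, add_zero]

/-- If the expansion in `w > z` has no singular part in `z` and the expansion in `z > w` has no
terms of `w`-index beyond `m`, then the `n`-th product has a single term. -/
theorem FactorsFinite.apply_phi (hl : FactorsFinite l) (n m : K)
    (hA : ∀ Y, ¬ IsInt K Y → l (iota Y) = 0) (hA' : ∀ k : ℕ, l (iota (m + (k + 1 : ℕ))) = 0)
    (hB : ∀ X, ¬ IsNegInt K X → l (kappa (m + n) X) = 0) :
    l (phi n (m + n)) = l (iota m) := by
  obtain ⟨S, hS⟩ := hl.exists_eq_zero_of_integral (m + n) hA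
    fun X hX => hB X fun ⟨k, _, hk⟩ => hX ⟨k, hk⟩
  by_cases hm : IsInt K m
  · obtain ⟨k, rfl⟩ := hm
    obtain ⟨J, hJ⟩ := exists_phi_eq_sum n k S
    set g₁ : K → K → K :=
      ∑ j ∈ Finset.range (J + 1), ((-1) ^ j * gchoose K n j) • iota ((k : K) + j) with hg₁
    set g₂ : K → K → K :=
      ∑ j ∈ Finset.range (J + 1), ((-1) ^ j * gchoose K n j) • kappa ((k : K) + n) j with hg₂
    have e₁ : l g₁ = l (iota (k : K)) := by
      rw [hg₁, Finset.sum_range_succ', map_add, map_sum, Finset.sum_eq_zero]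
      · simp
      · intro j _
        rw [map_smul, hA' j, smul_zero]
    have e₂ : l g₂ = 0 := by
      rw [hg₂, map_sum]
      refine Finset.sum_eq_zero fun j _ => ?_
      rw [map_smul, hB, smul_zero]
      rintro ⟨i, hi, hij⟩
      have : (i : ℤ) = (j : ℤ) := Int.cast_injective (α := K) (by simpa using hij)
      omega
    have hg₁' : IsRel g₁ := IsRel.of_mem_span (B := Set.range iota)
      (by rintro _ ⟨Y, rfl⟩; exact isRel_iota Y)
      (Submodule.sum_mem _ fun j _ => Submodule.smul_mem _ _ (Submodule.subset_span ⟨_, rfl⟩))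
    have hg₂' : IsRel (classSign n • g₂) := IsRel.of_mem_span (B := Set.range (kappa ((k : K) + n)))
      (by rintro _ ⟨Y, rfl⟩; exact isRel_kappa _ Y)
      (Submodule.smul_mem _ _ (Submodule.sum_mem _ fun j _ =>
        Submodule.smul_mem _ _ (Submodule.subset_span ⟨_, rfl⟩)))
    have hz := hS (phi n (k + n) - (g₁ - classSign n • g₂))
      ((isRel_phi _ _).sub (hg₁'.sub hg₂')) fun y h hyh hy hx => by
        simp only [Pi.sub_apply, hg₁, hg₂, Pi.smul_apply, Finset.sum_apply, smul_eq_mul]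
        rw [hJ y h hyh hy hx, sub_self]
    rw [map_sub, map_sub, map_smul, e₁, e₂, smul_zero, sub_zero, sub_eq_zero] at hz
    exact hz
  · rw [hA m hm]
    refine hS _ (isRel_phi _ _) fun y h _ hy hx => genChoose_of_not fun ⟨j, hj⟩ => hm ?_
    have : m = y + (m + n - y - h) + (j + 1) := by rw [hj]; ring
    rw [this]
    exact (hy.add hx).add ⟨j + 1, by push_cast; rfl⟩

end FiniteDependence

section Pairing

variable {K : Type*} [Field K] {E : Type*} [AddCommGroup E] [Module K E]

/-- Finiteness of the support on all antidiagonals. -/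
def DiagFinite (c : Dist2 K E) : Prop := ∀ t : Idx K, {y | c (t - y) y ≠ 0}.Finite

omit [Module K E] in
theorem InLat2.diagFinite [CharZero K] {c : Dist2 K E} (hc : InLat2 K E c) : DiagFinite c := by
  have key : ∀ p q t : K, {y : K | IsNegInt K (t - y - p) ∧ IsNegInt K (y - q)}.Finite := by
    intro p q t
    by_cases hr : IsInt K (t - p - q)
    · obtain ⟨N, hN⟩ := hr
      refine ((Finset.Ioo N 0).finite_toSet.image fun k : ℤ => q + (k : K)).subset ?_
      rintro y ⟨⟨k, hk, hk'⟩, ⟨l, hl, hl'⟩⟩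
      refine ⟨l, ?_, by simp only [hl']; ring⟩
      have : N = k + l := by
        apply Int.cast_injective (α := K)
        push_cast
        rw [hk', hl', hN]; ring
      simp only [Finset.coe_Ioo, Set.mem_Ioo]
      omega
    · convert Set.finite_empty
      refine Set.eq_empty_of_forall_notMem ?_
      rintro y ⟨⟨k, hk, hk'⟩, ⟨l, hl, hl'⟩⟩
      exact hr ⟨k + l, by push_cast; rw [hk', hl']; ring⟩
  intro t
  obtain ⟨S, hS⟩ := hc
  refine (S.finite_toSet.biUnion fun m _ =>
    (key m.1.1 m.2.1 t.1).prod (key m.1.2 m.2.2 t.2)).subset fun y hy => ?_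
  obtain ⟨m, hm, ⟨h1, h2⟩, h3, h4⟩ := hS _ _ hy
  exact Set.mem_biUnion hm ⟨⟨h1, h3⟩, ⟨h2, h4⟩⟩

variable {r : ℕ}

/-- The pairing of a finite family of symbols `z ^ x * w ^ y * (z - w) ^ (-h)` of total degree `M`
with a coefficient function of `(y, h)`. -/
def pairing (c : Fin r → Dist2 K E) (h : Fin r → Idx K) (hc : ∀ i, DiagFinite (c i))
    (M : Idx K) : (Idx K → Idx K → K) →ₗ[K] E where
  toFun F := ∑ i, ∑ᶠ y, F y (h i) • c i (M - h i - y) y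
  map_add' F G := by
    rw [← Finset.sum_add_distrib]
    refine Finset.sum_congr rfl fun i _ => ?_
    simp only [Pi.add_apply, add_smul]
    exact finsum_add_distrib ((hc i _).subset fun y hy => right_ne_zero_of_smul hy)
      ((hc i _).subset fun y hy => right_ne_zero_of_smul hy)
  map_smul' s F := by
    rw [RingHom.id_apply, Finset.smul_sum]
    refine Finset.sum_congr rfl fun i _ => ?_
    rw [smul_finsum' _ ((hc i _).subset fun y hy => right_ne_zero_of_smul hy)]
    simp only [Pi.smul_apply, smul_eq_mul, mul_smul]

theorem pairing_apply (c : Fin r → Dist2 K E) (h : Fin r → Idx K) (hc : ∀ i, DiagFinite (c i))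
    (M : Idx K) (F : Idx K → Idx K → K) :
    pairing c h hc M F = ∑ i, ∑ᶠ y, F y (h i) • c i (M - h i - y) y := rfl

theorem pairing_eq_zero (c : Fin r → Dist2 K E) (h : Fin r → Idx K)
    (hc : ∀ i, DiagFinite (c i)) (M : Idx K) :
    ∃ S : Finset (Idx K × Idx K), ∀ F : Idx K → Idx K → K,
      (∀ p ∈ S, F p.1 p.2 = 0) → pairing c h hc M F = 0 := by
  refine ⟨Finset.univ.biUnion fun i =>
    (hc i (M - h i)).toFinset.image fun y => (y, h i), fun F hF => ?_⟩
  rw [pairing_apply]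
  refine Finset.sum_eq_zero fun i _ => ?_
  refine finsum_eq_zero_of_forall_eq_zero fun y => ?_
  by_cases hy : c i (M - h i - y) y = 0
  · rw [hy, smul_zero]
  · rw [hF (y, h i), zero_smul]
    refine Finset.mem_biUnion.mpr ⟨i, Finset.mem_univ _, Finset.mem_image.mpr ⟨y, ?_, rfl⟩⟩
    simpa using hy

/-- The pairing with products of coefficient functions of the two components. -/
def biPairing (c : Fin r → Dist2 K E) (h : Fin r → Idx K) (hc : ∀ i, DiagFinite (c i))
    (M : Idx K) : (K → K → K) →ₗ[K] (K → K → K) →ₗ[K] E :=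
  LinearMap.mk₂ K (fun f g => pairing c h hc M fun y h => f y.1 h.1 * g y.2 h.2)
    (fun f f' g => by rw [← map_add]; congr 1; funext y h; simp [add_mul])
    (fun s f g => by rw [← map_smul]; congr 1; funext y h; simp [mul_assoc])
    (fun f g g' => by rw [← map_add]; congr 1; funext y h; simp [mul_add])
    (fun s f g => by rw [← map_smul]; congr 1; funext y h; simp [mul_left_comm])

theorem biPairing_apply (c : Fin r → Dist2 K E) (h : Fin r → Idx K)
    (hc : ∀ i, DiagFinite (c i)) (M : Idx K) (f g : K → K → K) :
    biPairing c h hc M f g = pairing c h hc M fun y h => f y.1 h.1 * g y.2 h.2 := rfl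

theorem factorsFinite_biPairing (c : Fin r → Dist2 K E) (h : Fin r → Idx K)
    (hc : ∀ i, DiagFinite (c i)) (M : Idx K) (f : K → K → K) :
    FactorsFinite (biPairing c h hc M f) := by
  obtain ⟨S, hS⟩ := pairing_eq_zero c h hc M
  refine ⟨S.image fun p => (p.1.2, p.2.2), fun g hg => ?_⟩
  rw [biPairing_apply]
  refine hS _ fun p hp => ?_
  rw [hg _ _ (Finset.mem_image_of_mem (fun p => (p.1.2, p.2.2)) hp), mul_zero]

theorem factorsFinite_biPairing_flip (c : Fin r → Dist2 K E) (h : Fin r → Idx K)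
    (hc : ∀ i, DiagFinite (c i)) (M : Idx K) (g : K → K → K) :
    FactorsFinite ((biPairing c h hc M).flip g) := by
  obtain ⟨S, hS⟩ := pairing_eq_zero c h hc M
  refine ⟨S.image fun p => (p.1.1, p.2.1), fun f hf => ?_⟩
  rw [LinearMap.flip_apply, biPairing_apply]
  refine hS _ fun p hp => ?_
  rw [hf _ _ (Finset.mem_image_of_mem (fun p => (p.1.1, p.2.1)) hp), zero_mul]

end Pairing

section Expansions

variable {K : Type*} [Field K] {E : Type*} [AddCommGroup E] [Module K E]

theorem finsum_comp_of_injective {α β G : Type*} [AddCommMonoid G] {e : α → β}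
    (he : Function.Injective e) {f : β → G} (hf : ∀ y, y ∉ Set.range e → f y = 0) :
    ∑ᶠ i, f (e i) = ∑ᶠ y, f y := by
  rw [← finsum_mem_range he]
  refine finsum_congr fun y => ?_
  by_cases hy : y ∈ Set.range e
  · exact finsum_eq_if.trans (if_pos hy)
  · rw [hf y hy]
    exact finsum_zero

variable [CharZero K]

theorem add_natCast_pair_injective (k : Idx K) :
    Function.Injective fun i : ℕ × ℕ => ((k.1 + i.1, k.2 + i.2) : Idx K) := by
  rintro ⟨i, i'⟩ ⟨j, j'⟩ hij
  simpa using hij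

theorem sub_natCast_pair_injective (k : Idx K) :
    Function.Injective fun i : ℕ × ℕ => ((k.1 - i.1, k.2 - i.2) : Idx K) := by
  rintro ⟨i, i'⟩ ⟨j, j'⟩ hij
  simpa using hij

theorem iota_add_natCast (Y h : K) (j : ℕ) : iota Y (Y + j) h = (-1) ^ j * gchoose K (-h) j := by
  rw [gchoose_neg, iota, add_sub_cancel_left, genChoose_natCast]

omit [CharZero K] in
theorem iota_eq_zero_of_forall_ne {Y y h : K} (hy : ∀ j : ℕ, y ≠ Y + j) : iota Y y h = 0 :=
  genChoose_of_not fun ⟨j, hj⟩ => hy j (by rw [hj]; ring)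

variable {r : ℕ} {c : Fin r → Dist2 K E} {h : Fin r → Idx K}

theorem sum_zwPow_eq_biPairing (hc : ∀ i, DiagFinite (c i)) (m k : Idx K) :
    ∑ i, zwPow K E (-(h i)) (c i) m k = biPairing c h hc (m + k) (iota k.1) (iota k.2) := by
  rw [biPairing_apply, pairing_apply]
  refine Finset.sum_congr rfl fun i _ => ?_
  rw [← finsum_comp_of_injective (add_natCast_pair_injective k)]
  · refine finsum_congr fun j => ?_
    rw [iota_add_natCast, iota_add_natCast, pow_add]
    congr 1
    · simp only [Prod.fst_neg, Prod.snd_neg]; ring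
    · congr 1
      ext <;> simp <;> ring
  · rintro y hy
    have : (∀ j : ℕ, y.1 ≠ k.1 + j) ∨ ∀ j : ℕ, y.2 ≠ k.2 + j := by
      by_contra! hcon
      obtain ⟨⟨j, hj⟩, j', hj'⟩ := hcon
      exact hy ⟨(j, j'), by ext <;> simp [hj, hj']⟩
    rcases this with h0 | h0
    · rw [iota_eq_zero_of_forall_ne h0, zero_mul, zero_smul]
    · rw [iota_eq_zero_of_forall_ne h0, mul_zero, zero_smul]

theorem sum_zwPowW_eq_biPairing (hc : ∀ i, DiagFinite (c i)) (hh : ∀ i, Kbar K (h i))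
    (m k : Idx K) :
    ∑ i, zwPowW K E (-(h i)) (c i) m k =
      biPairing c h hc (m + k) (kappa (m + k).1 m.1) (kappa (m + k).2 m.2) := by
  rw [biPairing_apply, pairing_apply]
  refine Finset.sum_congr rfl fun i _ => ?_
  rw [← finsum_comp_of_injective (sub_natCast_pair_injective (k - h i))]
  · refine finsum_congr fun j => ?_
    have e1 : (m + k).1 - ((k - h i).1 - (j.1 : K)) - (h i).1 = m.1 + j.1 := by
      simp only [Prod.fst_add, Prod.fst_sub]; ring
    have e2 : (m + k).2 - ((k - h i).2 - (j.2 : K)) - (h i).2 = m.2 + j.2 := by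
      simp only [Prod.snd_add, Prod.snd_sub]; ring
    rw [kappa_apply, kappa_apply, e1, e2, iota_add_natCast, iota_add_natCast]
    congr 1
    · have hs := classSign_mul_classSign (hh i)
      have hs' : negOnePow K ((-h i).1 - (-h i).2) = negOnePow K ((h i).1 - (h i).2) := by
        obtain ⟨l, hl⟩ := hh i
        have : (-h i).1 - (-h i).2 = ((-l : ℤ) : K) := by
          push_cast; rw [hl]; simp only [Prod.fst_neg, Prod.snd_neg]; ring
        rw [this, ← hl, negOnePow_intCast, negOnePow_intCast, zpow_neg, ← inv_zpow, inv_neg,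
          inv_one]
      rw [hs', ← hs, pow_add]
      simp only [Prod.fst_neg, Prod.snd_neg]; ring
    · congr 1
      · ext <;> simp <;> ring
      · ext <;> simp <;> ring
  · rintro y hy
    have : (∀ j : ℕ, (m + k).1 - y.1 - (h i).1 ≠ m.1 + j) ∨
        ∀ j : ℕ, (m + k).2 - y.2 - (h i).2 ≠ m.2 + j := by
      by_contra! hcon
      obtain ⟨⟨j, hj⟩, j', hj'⟩ := hcon
      refine hy ⟨(j, j'), ?_⟩
      ext
      · simp only [Prod.fst_sub, Prod.fst_add] at hj ⊢
        linear_combination hj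
      · simp only [Prod.snd_sub, Prod.snd_add] at hj' ⊢
        linear_combination hj'
    rcases this with h0 | h0
    · rw [kappa_apply, iota_eq_zero_of_forall_ne h0, mul_zero, zero_mul, zero_smul]
    · rw [kappa_apply (M := (m + k).2), iota_eq_zero_of_forall_ne h0, mul_zero, mul_zero,
        zero_smul]

theorem neg_mul_factorial_mul_genChoose (x : K) (j : ℕ) :
    -x * ((j.factorial : K) * genChoose (j - (x - 1) - 1) j) =
      ((j + 1).factorial : K) * genChoose ((j + 1 : ℕ) - x - 1) (j + 1 : ℕ) := by
  have h := succ_mul_gchoose_succ (j - x) j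
  rw [genChoose_natCast, genChoose_natCast, show (j : K) - (x - 1) - 1 = j - x by ring,
    show ((j + 1 : ℕ) : K) - x - 1 = j - x by push_cast; ring, Nat.factorial_succ]
  push_cast
  linear_combination (-(j.factorial : K)) * h

theorem dPow_d1z (e : K) (c : Dist2 K E) (n k : Idx K) :
    dPow K (d1z K E) e c n k = genChoose (e - n.1 - 1) e • c (n.1 - e, n.2) k := by
  by_cases he : ∃ j : ℕ, (j : K) = e
  · have key : ∀ (j : ℕ) (n : Idx K), (d1z K E)^[j] c n k =
        ((j.factorial : K) * genChoose (j - n.1 - 1) j) • c (n.1 - j, n.2) k := by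
      intro j
      induction j with
      | zero => intro n; rw [genChoose_natCast]; simp
      | succ j ih =>
        intro n
        rw [Function.iterate_succ_apply', d1z, ih, smul_smul, neg_mul_factorial_mul_genChoose]
        congr 2
        ext <;> simp
        ring
    have h0 : (he.choose.factorial : K) ≠ 0 := by exact_mod_cast he.choose.factorial_ne_zero
    rw [dPow, dif_pos he]
    simp only [Pi.smul_apply]
    rw [key, he.choose_spec, mul_smul, inv_smul_smul₀ h0]
  · rw [dPow, dif_neg he, genChoose_of_not he, zero_smul]
    rfl

theorem dPow_d1zb (e : K) (c : Dist2 K E) (n k : Idx K) :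
    dPow K (d1zb K E) e c n k = genChoose (e - n.2 - 1) e • c (n.1, n.2 - e) k := by
  by_cases he : ∃ j : ℕ, (j : K) = e
  · have key : ∀ (j : ℕ) (n : Idx K), (d1zb K E)^[j] c n k =
        ((j.factorial : K) * genChoose (j - n.2 - 1) j) • c (n.1, n.2 - j) k := by
      intro j
      induction j with
      | zero => intro n; rw [genChoose_natCast]; simp
      | succ j ih =>
        intro n
        rw [Function.iterate_succ_apply', d1zb, ih, smul_smul, neg_mul_factorial_mul_genChoose]
        congr 2
        ext <;> simp
        ring
    have h0 : (he.choose.factorial : K) ≠ 0 := by exact_mod_cast he.choose.factorial_ne_zero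
    rw [dPow, dif_pos he]
    simp only [Pi.smul_apply]
    rw [key, he.choose_spec, mul_smul, inv_smul_smul₀ h0]
  · rw [dPow, dif_neg he, genChoose_of_not he, zero_smul]
    rfl

theorem prodAt_eq_biPairing {cE : Fin r → EDist2 K E} {v : E}
    (hc : ∀ i, DiagFinite (ev2 K E (cE i) v)) (n m : Idx K) :
    prodAt K E cE h n v m =
      biPairing (fun i => ev2 K E (cE i) v) h hc (m + n) (phi n.1 (m.1 + n.1))
        (phi n.2 (m.2 + n.2)) := by
  rw [biPairing_apply, pairing_apply, prodAt]
  refine Finset.sum_congr rfl fun i _ => ?_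
  rw [diag]
  rw [← finsum_comp_equiv ((Equiv.subLeft (m - 1)) : Idx K ≃ Idx K)]
  refine finsum_congr fun y => ?_
  rw [ddPow2, dPow_d1z, dPow_d1zb, smul_smul, phi, phi]
  congr 1
  · congr 2 <;> simp <;> ring
  · congr 1 <;> ext <;> simp <;> ring

end Expansions

section Translation

variable {K : Type*} [Field K] {E : Type*} [AddCommGroup E] [Module K E]

/-- The commutator of a family of operators with `S` minus the total derivative, applied to a
vector, where `c` and `c'` are the family applied to the vector and to its image under `S`. -/
def translationDefect (S : Module.End K E) (l : Idx K →ₗ[K] K) (u : Idx K) (c c' : Dist2 K E) :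
    Dist2 K E :=
  fun x y => S (c x y) - c' x y + l x • c (x - u) y + l y • c x (y - u)

omit [Module K E] in
theorem DiagFinite.shift_left {c : Dist2 K E} (hc : DiagFinite c) (u : Idx K) (t : Idx K) :
    {y | c (t - y - u) y ≠ 0}.Finite := by
  have := hc (t - u)
  simpa only [sub_right_comm t u] using this

omit [Module K E] in
theorem DiagFinite.shift_right {c : Dist2 K E} (hc : DiagFinite c) (u : Idx K) (t : Idx K) :
    {y | c (t - y) (y - u) ≠ 0}.Finite := by
  refine ((hc (t - u)).preimage (f := fun y => y - u) (sub_left_injective.injOn)).subset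
    fun y hy => ?_
  simpa using hy

theorem DiagFinite.translationDefect {c c' : Dist2 K E} (hc : DiagFinite c) (hc' : DiagFinite c')
    (S : Module.End K E) (l : Idx K →ₗ[K] K) (u : Idx K) :
    DiagFinite (translationDefect S l u c c') := by
  intro t
  refine ((((hc t).union (hc' t)).union (hc.shift_left u t)).union (hc.shift_right u t)).subset
    fun y hy => ?_
  contrapose! hy
  simp only [Set.mem_union, Set.mem_ofPred_eq, not_or, not_not] at hy ⊢
  obtain ⟨⟨⟨h1, h2⟩, h3⟩, h4⟩ := hy
  simp [OPEA.translationDefect, h1, h2, h3, h4]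

variable {r : ℕ} {c c' : Fin r → Dist2 K E}

theorem pairing_translationDefect (S : Module.End K E) (l : Idx K →ₗ[K] K) (u : Idx K)
    (h : Fin r → Idx K) (hc : ∀ i, DiagFinite (c i)) (hc' : ∀ i, DiagFinite (c' i))
    (M : Idx K) (F : Idx K → Idx K → K) :
    pairing (fun i => translationDefect S l u (c i) (c' i)) h
        (fun i => (hc i).translationDefect (hc' i) S l u) M F =
      S (pairing c h hc M F) - pairing c' h hc' M F +
        pairing c h hc (M - u) fun y k => l (M - k - y) * F y k + l (y + u) * F (y + u) k := by
  simp only [pairing_apply]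
  rw [map_sum, ← Finset.sum_sub_distrib, ← Finset.sum_add_distrib]
  refine Finset.sum_congr rfl fun i _ => ?_
  set t := M - h i with ht
  have hs : ∀ y, M - u - h i - y = t - y - u := fun y => by rw [ht]; abel
  have f1 : (Function.support fun y => F y (h i) • S (c i (t - y) y)).Finite :=
    (hc i t).subset fun y hy h0 => hy (by simp [h0])
  have f2 : (Function.support fun y => F y (h i) • c' i (t - y) y).Finite :=
    (hc' i t).subset fun y hy => right_ne_zero_of_smul hy
  have f3 : (Function.support fun y => (l (t - y) * F y (h i)) • c i (t - y - u) y).Finite :=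
    ((hc i).shift_left u t).subset fun y hy => right_ne_zero_of_smul hy
  have f4 : (Function.support fun y => (l y * F y (h i)) • c i (t - y) (y - u)).Finite :=
    ((hc i).shift_right u t).subset fun y hy => right_ne_zero_of_smul hy
  have f5 : (Function.support fun y =>
      (l (y + u) * F (y + u) (h i)) • c i (t - y - u) y).Finite :=
    ((hc i).shift_left u t).subset fun y hy => right_ne_zero_of_smul hy
  have e1 : S (∑ᶠ y, F y (h i) • c i (t - y) y) = ∑ᶠ y, F y (h i) • S (c i (t - y) y) := by
    rw [← LinearMap.toAddMonoidHom_coe, AddMonoidHom.map_finsum]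
    · simp
    · exact (hc i t).subset fun y hy => right_ne_zero_of_smul hy
  have e4 : ∑ᶠ y, (l y * F y (h i)) • c i (t - y) (y - u) =
      ∑ᶠ y, (l (y + u) * F (y + u) (h i)) • c i (t - y - u) y := by
    rw [← finsum_comp_equiv (Equiv.addRight u)]
    refine finsum_congr fun y => ?_
    simp only [Equiv.coe_addRight, add_sub_cancel_right, sub_add_eq_sub_sub]
  simp only [hs, add_smul]
  rw [finsum_add_distrib f3 f5, ← e4, e1, ← finsum_sub_distrib f1 f2, ← add_assoc,
    ← finsum_add_distrib ((f1.union f2).subset (Function.support_sub _ _)) f3,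
    ← finsum_add_distrib (((f1.union f2).subset (Function.support_sub _ _)).union f3 |>.subset
      (Function.support_add _ _)) f4]
  refine finsum_congr fun y => ?_
  simp only [translationDefect, smul_add, smul_sub, smul_smul, mul_comm]

/-- The operator on coefficient functions dual to the total derivative. -/
def derivDual (M : K) (f : K → K → K) : K → K → K :=
  fun y k => (M - k - y) * f y k + (y + 1) * f (y + 1) k

theorem biPairing_translationDefect_fst (S : Module.End K E)
    (h : Fin r → Idx K) (hc : ∀ i, DiagFinite (c i)) (hc' : ∀ i, DiagFinite (c' i))
    (M : Idx K) (f g : K → K → K) :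
    biPairing (fun i => translationDefect S (LinearMap.fst K K K) (1, 0) (c i) (c' i)) h
        (fun i => (hc i).translationDefect (hc' i) S _ _) M f g =
      S (biPairing c h hc M f g) - biPairing c' h hc' M f g +
        biPairing c h hc (M - (1, 0)) (derivDual M.1 f) g := by
  simp only [biPairing_apply]
  refine (pairing_translationDefect S _ _ h hc hc' M _).trans ?_
  congr 2
  funext y k
  simp [derivDual]
  ring

theorem biPairing_translationDefect_snd (S : Module.End K E)
    (h : Fin r → Idx K) (hc : ∀ i, DiagFinite (c i)) (hc' : ∀ i, DiagFinite (c' i))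
    (M : Idx K) (f g : K → K → K) :
    biPairing (fun i => translationDefect S (LinearMap.snd K K K) (0, 1) (c i) (c' i)) h
        (fun i => (hc i).translationDefect (hc' i) S _ _) M f g =
      S (biPairing c h hc M f g) - biPairing c' h hc' M f g +
        biPairing c h hc (M - (0, 1)) f (derivDual M.2 g) := by
  simp only [biPairing_apply]
  refine (pairing_translationDefect S _ _ h hc hc' M _).trans ?_
  congr 2
  funext y k
  simp [derivDual]
  ring

variable [CharZero K]

theorem derivDual_iota (M Y : K) :
    derivDual M (iota Y) = (M - Y) • iota Y + Y • iota (Y - 1) := by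
  funext y k
  have h1 := succ_mul_genChoose (k + (y - Y) - 1) (y - Y)
  simp only [derivDual, iota, Pi.add_apply, Pi.smul_apply, smul_eq_mul]
  rw [show k + (y + 1 - Y) - 1 = k + (y - Y) - 1 + 1 by ring, show y + 1 - Y = y - Y + 1 by ring,
    show k + (y - (Y - 1)) - 1 = k + (y - Y) - 1 + 1 by ring,
    show y - (Y - 1) = y - Y + 1 by ring]
  linear_combination h1

theorem derivDual_phi (n m : K) :
    derivDual (m + n) (phi n (m + n)) = m • phi n (m + n - 1) := by
  funext y k
  have h1 := mul_genChoose_pred (y + k - (m + n)) (k - 1 - n)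
  simp only [derivDual, phi, Pi.smul_apply, smul_eq_mul]
  rw [show y + 1 + k - (m + n) - 1 = y + k - (m + n) by ring,
    show y + k - (m + n - 1) - 1 = y + k - (m + n) by ring]
  linear_combination -h1

end Translation

section OPE

variable {K : Type*} [Field K] [CharZero K] {E : Type*} [AddCommGroup E] [Module K E]

theorem biPairing_eq_zero_of_iota {r : ℕ} {c : Fin r → Dist2 K E} {h : Fin r → Idx K}
    {hc : ∀ i, DiagFinite (c i)} {M : Idx K}
    (h0 : ∀ Y Y', biPairing c h hc M (iota Y) (iota Y') = 0) {f g : K → K → K}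
    (hf : IsRel f) (hg : IsRel g) : biPairing c h hc M f g = 0 :=
  (factorsFinite_biPairing_flip c h hc M g).eq_zero_of_forall_iota (fun Y =>
    (factorsFinite_biPairing c h hc M (iota Y)).eq_zero_of_forall_iota (h0 Y) hg) hf

variable {a b : EDist1 K E} {pa pb : ZMod 2} {r : ℕ} {c : Fin r → EDist2 K E} {h : Fin r → Idx K}

theorem IsOPE.diagFinite (hch : IsOPE K E pa pb a b c h) (v : E) (i : Fin r) :
    DiagFinite (ev2 K E (c i) v) :=
  (hch.2.1 i v).diagFinite

/-- The pairing of an OPE, applied to a vector, with products of coefficient functions. -/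
def IsOPE.coeff (hch : IsOPE K E pa pb a b c h) (v : E) (M : Idx K) :
    (K → K → K) →ₗ[K] (K → K → K) →ₗ[K] E :=
  biPairing (fun i => ev2 K E (c i) v) h (hch.diagFinite v) M

theorem IsOPE.coeff_iota (hch : IsOPE K E pa pb a b c h) (v : E) (M : Idx K) (Y Y' : K) :
    hch.coeff v M (iota Y) (iota Y') = a (M.1 - Y, M.2 - Y') (b (Y, Y') v) := by
  have := sum_zwPow_eq_biPairing (h := h) (hch.diagFinite v) (M.1 - Y, M.2 - Y') (Y, Y')
  rw [← hch.2.2.1] at this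
  rw [this, IsOPE.coeff]
  simp

theorem IsOPE.coeff_kappa (hch : IsOPE K E pa pb a b c h) (v : E) (M : Idx K) (X X' : K) :
    hch.coeff v M (kappa M.1 X) (kappa M.2 X') =
      koszul K pa pb • b (M.1 - X, M.2 - X') (a (X, X') v) := by
  have := sum_zwPowW_eq_biPairing (h := h) (hch.diagFinite v) hch.1 (X, X') (M.1 - X, M.2 - X')
  rw [← hch.2.2.2] at this
  rw [this, IsOPE.coeff]
  simp

theorem IsOPE.prodAt_eq (hch : IsOPE K E pa pb a b c h) (n : Idx K) (v : E) (m : Idx K) :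
    prodAt K E c h n v m =
      hch.coeff v (m + n) (phi n.1 (m.1 + n.1)) (phi n.2 (m.2 + n.2)) :=
  prodAt_eq_biPairing (hch.diagFinite v) n m

theorem IsOPE.prodAt_eq_zero (hch : IsOPE K E pa pb a b c h) {v : E}
    (h0 : ∀ k, b k v = 0) (n m : Idx K) : prodAt K E c h n v m = 0 := by
  rw [hch.prodAt_eq]
  refine biPairing_eq_zero_of_iota (fun Y Y' => ?_) (isRel_phi _ _) (isRel_phi _ _)
  refine (hch.coeff_iota v (m + n) Y Y').trans ?_
  rw [h0, map_zero]

theorem IsOPE.transCovAt_fst {T : Module.End K E} (hch : IsOPE K E pa pb a b c h)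
    (ha : ∀ n : Idx K, T * a n - a n * T = (-n.1) • a (n.1 - 1, n.2))
    (hb : ∀ n : Idx K, T * b n - b n * T = (-n.1) • b (n.1 - 1, n.2)) (n : Idx K)
    (v : E) (m : Idx K) :
    T (prodAt K E c h n v m) - prodAt K E c h n (T v) m =
      (-m.1) • prodAt K E c h n v (m.1 - 1, m.2) := by
  have hz := biPairing_translationDefect_fst T h (hch.diagFinite v) (hch.diagFinite (T v)) (m + n)
  have h0 := biPairing_eq_zero_of_iota (fun Y Y' => by
    have e1 := LinearMap.congr_fun (ha ((m + n).1 - Y, (m + n).2 - Y')) (b (Y, Y') v)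
    have e2 := congrArg (a ((m + n).1 - Y, (m + n).2 - Y')) (LinearMap.congr_fun (hb (Y, Y')) v)
    have i1 := hch.coeff_iota v (m + n) Y Y'
    have i2 := hch.coeff_iota (T v) (m + n) Y Y'
    have i3 := hch.coeff_iota v (m + n - (1, 0)) Y Y'
    have i4 := hch.coeff_iota v (m + n - (1, 0)) (Y - 1) Y'
    unfold IsOPE.coeff at i1 i2 i3 i4
    simp only [LinearMap.sub_apply, Module.End.mul_apply, LinearMap.smul_apply, map_sub,
      map_smul] at e1 e2
    rw [hz, derivDual_iota, map_add, map_smul, map_smul, LinearMap.add_apply,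
      LinearMap.smul_apply, LinearMap.smul_apply, i1, i2, i3, i4]
    simp only [Prod.fst_sub, Prod.snd_sub, sub_zero, sub_sub_sub_cancel_right]
    rw [sub_right_comm _ (1 : K) Y]
    linear_combination (norm := module) e1 + e2)
    (isRel_phi n.1 (m.1 + n.1)) (isRel_phi n.2 (m.2 + n.2))
  rw [hz, Prod.fst_add, derivDual_phi, map_smul, LinearMap.smul_apply] at h0
  have e : ((m.1 - 1, m.2) : Idx K) + n = m + n - (1, 0) := by ext <;> simp; ring
  have e' : m.1 - 1 + n.1 = m.1 + n.1 - 1 := by ring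
  rw [hch.prodAt_eq, hch.prodAt_eq, hch.prodAt_eq, e, e']
  unfold IsOPE.coeff
  linear_combination (norm := module) h0

theorem IsOPE.transCovAt_snd {T : Module.End K E} (hch : IsOPE K E pa pb a b c h)
    (ha : ∀ n : Idx K, T * a n - a n * T = (-n.2) • a (n.1, n.2 - 1))
    (hb : ∀ n : Idx K, T * b n - b n * T = (-n.2) • b (n.1, n.2 - 1)) (n : Idx K)
    (v : E) (m : Idx K) :
    T (prodAt K E c h n v m) - prodAt K E c h n (T v) m =
      (-m.2) • prodAt K E c h n v (m.1, m.2 - 1) := by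
  have hz := biPairing_translationDefect_snd T h (hch.diagFinite v) (hch.diagFinite (T v)) (m + n)
  have h0 := biPairing_eq_zero_of_iota (fun Y Y' => by
    have e1 := LinearMap.congr_fun (ha ((m + n).1 - Y, (m + n).2 - Y')) (b (Y, Y') v)
    have e2 := congrArg (a ((m + n).1 - Y, (m + n).2 - Y')) (LinearMap.congr_fun (hb (Y, Y')) v)
    have i1 := hch.coeff_iota v (m + n) Y Y'
    have i2 := hch.coeff_iota (T v) (m + n) Y Y'
    have i3 := hch.coeff_iota v (m + n - (0, 1)) Y Y'
    have i4 := hch.coeff_iota v (m + n - (0, 1)) Y (Y' - 1)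
    unfold IsOPE.coeff at i1 i2 i3 i4
    simp only [LinearMap.sub_apply, Module.End.mul_apply, LinearMap.smul_apply, map_sub,
      map_smul] at e1 e2
    rw [hz, derivDual_iota, map_add, map_smul, map_smul,
      i1, i2, i3, i4]
    simp only [Prod.fst_sub, Prod.snd_sub, sub_zero, sub_sub_sub_cancel_right]
    rw [sub_right_comm _ (1 : K) Y']
    linear_combination (norm := module) e1 + e2)
    (isRel_phi n.1 (m.1 + n.1)) (isRel_phi n.2 (m.2 + n.2))
  rw [hz, Prod.snd_add, derivDual_phi, map_smul] at h0
  have e : ((m.1, m.2 - 1) : Idx K) + n = m + n - (0, 1) := by ext <;> simp; ring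
  have e' : m.2 - 1 + n.2 = m.2 + n.2 - 1 := by ring
  rw [hch.prodAt_eq, hch.prodAt_eq, hch.prodAt_eq, e, e']
  unfold IsOPE.coeff
  linear_combination (norm := module) h0

end OPE

section Creative

variable {K : Type*} [Field K] [CharZero K] {E : Type*} [AddCommGroup E] [Module K E]

omit [CharZero K] in
theorem isNegInt_iff {x : K} : IsNegInt K x ↔ ∃ i : ℕ, x = -(i : K) - 1 := by
  constructor
  · rintro ⟨k, hk, rfl⟩
    refine ⟨(-k - 1).toNat, ?_⟩
    have : ((-k - 1).toNat : ℤ) = -k - 1 := by omega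
    rw [← Int.cast_natCast, this]
    push_cast; ring
  · rintro ⟨i, rfl⟩
    exact ⟨-(i : ℤ) - 1, by omega, by push_cast; ring⟩

variable {T Tb : Module.End K E} {one : E} {b : EDist1 K E}

omit [CharZero K] in
theorem CreativeD.eq_zero (hb : CreativeD K E T Tb (ev1 K E b one)) {n : Idx K}
    (hn : ¬ IsNegInt K n.1 ∨ ¬ IsNegInt K n.2) : b n one = 0 := by
  refine hb.2 n ?_
  rintro ⟨i, hi⟩
  rcases hn with hn | hn
  · exact hn (isNegInt_iff.mpr ⟨i.1, by rw [hi]⟩)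
  · exact hn (isNegInt_iff.mpr ⟨i.2, by rw [hi]⟩)

theorem CreativeD.apply_fst (hb : CreativeD K E T Tb (ev1 K E b one))
    (ht : TransCov K E T Tb b) (n : Idx K) : b n (T one) = 0 := by
  have e := LinearMap.congr_fun (ht.1 n) one
  simp only [LinearMap.sub_apply, Module.End.mul_apply, LinearMap.smul_apply] at e
  by_cases hn2 : IsNegInt K n.2
  · obtain ⟨j, hj⟩ := isNegInt_iff.mp hn2
    by_cases hn1 : IsNegInt K n.1
    · obtain ⟨i, hi⟩ := isNegInt_iff.mp hn1
      have e1 := hb.1 (i, j)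
      have e2 := hb.1 (i + 1, j)
      simp only [ev1] at e1 e2
      rw [show n = (-(i : K) - 1, -(j : K) - 1) from Prod.ext hi hj, e1,
        show (-(i : K) - 1 - 1) = -((i + 1 : ℕ) : K) - 1 by push_cast; ring, e2, map_smul,
        smul_smul, pow_succ', mul_assoc, Module.End.mul_apply, sub_eq_iff_eq_add] at e
      have hc : -(-(i : K) - 1) * (((i + 1).factorial : K)⁻¹ * (j.factorial : K)⁻¹) =
          (i.factorial : K)⁻¹ * (j.factorial : K)⁻¹ := by
        have h1 : (i : K) + 1 ≠ 0 := by exact_mod_cast i.succ_ne_zero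
        rw [Nat.factorial_succ]; push_cast; field_simp; ring
      rw [hc] at e
      simp only [Module.End.mul_apply] at e
      rw [left_eq_add] at e
      rw [show n = (-(i : K) - 1, -(j : K) - 1) from Prod.ext hi hj, e]
    · rw [hb.eq_zero (Or.inl hn1), map_zero] at e
      have : n.1 • b (n.1 - 1, n.2) one = 0 := by
        by_cases h0 : n.1 = 0
        · rw [h0, zero_smul]
        · rw [hb.eq_zero, smul_zero]
          refine Or.inl fun hx => ?_
          obtain ⟨i, hi⟩ := isNegInt_iff.mp hx
          rcases i with _ | i
          · exact h0 (by simpa using hi)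
          · refine hn1 (isNegInt_iff.mpr ⟨i, ?_⟩)
            push_cast at hi
            linear_combination hi
      rw [neg_smul, this, zero_sub, neg_zero, neg_eq_zero] at e
      exact e
  · rwa [hb.eq_zero (Or.inr hn2), map_zero, hb.eq_zero (n := (n.1 - 1, n.2)) (Or.inr hn2),
      smul_zero, zero_sub, neg_eq_zero] at e

theorem CreativeD.apply_snd (hb : CreativeD K E T Tb (ev1 K E b one))
    (ht : TransCov K E T Tb b) {n : Idx K} (hn : ∀ k : ℕ, n.1 ≠ -1 - ((k + 1 : ℕ) : K)) :
    b n (Tb one) = 0 := by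
  have e := LinearMap.congr_fun (ht.2 n) one
  simp only [LinearMap.sub_apply, Module.End.mul_apply, LinearMap.smul_apply] at e
  by_cases hn1 : IsNegInt K n.1
  · have hi : n.1 = -1 := by
      obtain ⟨i, hi⟩ := isNegInt_iff.mp hn1
      rcases i with _ | i
      · simpa using hi
      · exact absurd (by rw [hi]; ring) (hn i)
    by_cases hn2 : IsNegInt K n.2
    · obtain ⟨j, hj⟩ := isNegInt_iff.mp hn2
      have e1 := hb.1 (0, j)
      have e2 := hb.1 (0, j + 1)
      simp only [ev1, Nat.cast_zero, neg_zero, zero_sub, Nat.factorial_zero, Nat.cast_one,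
        inv_one, one_mul, pow_zero] at e1 e2
      rw [show n = (-1, -(j : K) - 1) from Prod.ext hi hj, e1,
        show (-(j : K) - 1 - 1) = -((j + 1 : ℕ) : K) - 1 by push_cast; ring, e2, map_smul,
        smul_smul, pow_succ', Module.End.mul_apply, sub_eq_iff_eq_add] at e
      have hc : -(-(j : K) - 1) * ((j + 1).factorial : K)⁻¹ = (j.factorial : K)⁻¹ := by
        have h1 : (j : K) + 1 ≠ 0 := by exact_mod_cast j.succ_ne_zero
        rw [Nat.factorial_succ]; push_cast; field_simp; ring
      rw [hc, left_eq_add] at e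
      rw [show n = (-1, -(j : K) - 1) from Prod.ext hi hj, e]
    · rw [hb.eq_zero (Or.inr hn2), map_zero] at e
      have : n.2 • b (n.1, n.2 - 1) one = 0 := by
        by_cases h0 : n.2 = 0
        · rw [h0, zero_smul]
        · rw [hb.eq_zero, smul_zero]
          refine Or.inr fun hx => ?_
          obtain ⟨i, hi⟩ := isNegInt_iff.mp hx
          rcases i with _ | i
          · exact h0 (by simpa using hi)
          · refine hn2 (isNegInt_iff.mpr ⟨i, ?_⟩)
            push_cast at hi
            linear_combination hi
      rw [neg_smul, this, zero_sub, neg_zero, neg_eq_zero] at e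
      exact e
  · rwa [hb.eq_zero (Or.inl hn1), map_zero, hb.eq_zero (n := (n.1, n.2 - 1)) (Or.inl hn1),
      smul_zero, zero_sub, neg_eq_zero] at e

variable {a : EDist1 K E} {pa pb : ZMod 2} {r : ℕ} {c : Fin r → EDist2 K E} {h : Fin r → Idx K}

theorem IsOPE.coeff_iota_left_eq_zero (hch : IsOPE K E pa pb a b c h) {v : E} {Y : K}
    (h0 : ∀ Y', b (Y, Y') v = 0) (M : Idx K) {g : K → K → K} (hg : IsRel g) :
    hch.coeff v M (iota Y) g = 0 :=
  (factorsFinite_biPairing _ h (hch.diagFinite v) M (iota Y)).eq_zero_of_forall_iota (fun Y' =>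
    (hch.coeff_iota v M Y Y').trans (by rw [h0, map_zero])) hg

theorem IsOPE.coeff_iota_right_eq_zero (hch : IsOPE K E pa pb a b c h) {v : E} {Y' : K}
    (h0 : ∀ Y, b (Y, Y') v = 0) (M : Idx K) {f : K → K → K} (hf : IsRel f) :
    hch.coeff v M f (iota Y') = 0 :=
  (factorsFinite_biPairing_flip _ h (hch.diagFinite v) M (iota Y')).eq_zero_of_forall_iota
    (fun Y => (hch.coeff_iota v M Y Y').trans (by rw [h0, map_zero])) hf

theorem IsOPE.coeff_phi_left (hch : IsOPE K E pa pb a b c h) {v : E} (n m : Idx K)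
    (hA : ∀ Y Y', ¬ IsInt K Y → b (Y, Y') v = 0)
    (hA' : ∀ (k : ℕ) (Y' : K), b (m.1 + ((k + 1 : ℕ) : K), Y') v = 0)
    (hB : ∀ X X', ¬ IsNegInt K X → a (X, X') v = 0) {g : K → K → K} (hg : IsRel g) :
    hch.coeff v (m + n) (phi n.1 (m.1 + n.1)) g = hch.coeff v (m + n) (iota m.1) g := by
  refine (factorsFinite_biPairing_flip _ h (hch.diagFinite v) (m + n) g).apply_phi n.1 m.1
    (fun Y hY => hch.coeff_iota_left_eq_zero (fun Y' => hA Y Y' hY) _ hg)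
    (fun k => hch.coeff_iota_left_eq_zero (fun Y' => hA' k Y') _ hg) fun X hX => ?_
  refine (factorsFinite_biPairing _ h (hch.diagFinite v) (m + n) _).eq_zero_of_forall_kappa
    (m + n).2 (fun X' => (hch.coeff_kappa v (m + n) X X').trans ?_) hg
  rw [hB X X' hX, map_zero, smul_zero]

theorem IsOPE.coeff_phi_right (hch : IsOPE K E pa pb a b c h) {v : E} (n m : Idx K)
    (hA : ∀ Y Y', ¬ IsInt K Y' → b (Y, Y') v = 0)
    (hA' : ∀ (k : ℕ) (Y : K), b (Y, m.2 + ((k + 1 : ℕ) : K)) v = 0)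
    (hB : ∀ X X', ¬ IsNegInt K X' → a (X, X') v = 0) {f : K → K → K} (hf : IsRel f) :
    hch.coeff v (m + n) f (phi n.2 (m.2 + n.2)) = hch.coeff v (m + n) f (iota m.2) := by
  refine (factorsFinite_biPairing _ h (hch.diagFinite v) (m + n) f).apply_phi n.2 m.2
    (fun Y' hY' => hch.coeff_iota_right_eq_zero (fun Y => hA Y Y' hY') _ hf)
    (fun k => hch.coeff_iota_right_eq_zero (fun Y => hA' k Y) _ hf) fun X' hX' => ?_
  refine (factorsFinite_biPairing_flip _ h (hch.diagFinite v) (m + n) _).eq_zero_of_forall_kappa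
    (m + n).1 (fun X => (hch.coeff_kappa v (m + n) X X').trans ?_) hf
  rw [hB X X' hX', map_zero, smul_zero]

omit [CharZero K] in
theorem IsNegInt.isInt {x : K} (hx : IsNegInt K x) : IsInt K x := ⟨hx.choose, hx.choose_spec.2⟩

theorem not_isNegInt_add_natCast {x : K} (hx : IsNegInt K x → x = -1) (k : ℕ) :
    ¬ IsNegInt K (x + ((k + 1 : ℕ) : K)) := by
  intro hk
  obtain ⟨i, hi⟩ := isNegInt_iff.mp hk
  have hx' := hx (isNegInt_iff.mpr ⟨i + (k + 1), by push_cast at hi ⊢; linear_combination hi⟩)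
  rw [hx'] at hi
  have : ((k + 1 + i : ℕ) : K) = 0 := by push_cast at hi ⊢; linear_combination hi
  rw [Nat.cast_eq_zero] at this
  omega

theorem IsOPE.prodAt_eq_zero_of_creative (hch : IsOPE K E pa pb a b c h)
    (ha : CreativeD K E T Tb (ev1 K E a one)) (hb : CreativeD K E T Tb (ev1 K E b one))
    (n : Idx K) {m : Idx K} (hm : ¬ IsNegInt K m.1 ∨ ¬ IsNegInt K m.2) :
    prodAt K E c h n one m = 0 := by
  rw [hch.prodAt_eq]
  rcases hm with hm | hm
  · rw [hch.coeff_phi_left n m (fun Y Y' hY => hb.eq_zero (Or.inl fun hn => hY hn.isInt))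
      (fun k Y' => hb.eq_zero (Or.inl (not_isNegInt_add_natCast (fun hn => absurd hn hm) k)))
      (fun X X' hX => ha.eq_zero (Or.inl hX)) (isRel_phi _ _)]
    exact hch.coeff_iota_left_eq_zero (fun Y' => hb.eq_zero (Or.inl hm)) _ (isRel_phi _ _)
  · rw [hch.coeff_phi_right n m (fun Y Y' hY => hb.eq_zero (Or.inr fun hn => hY hn.isInt))
      (fun k Y' => hb.eq_zero (Or.inr (not_isNegInt_add_natCast (fun hn => absurd hn hm) k)))
      (fun X X' hX => ha.eq_zero (Or.inr hX)) (isRel_phi _ _)]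
    exact hch.coeff_iota_right_eq_zero (fun Y' => hb.eq_zero (Or.inr hm)) _ (isRel_phi _ _)

theorem IsOPE.prodAt_neg_one (hch : IsOPE K E pa pb a b c h)
    (ha : CreativeD K E T Tb (ev1 K E a one)) (hb : CreativeD K E T Tb (ev1 K E b one))
    (n : Idx K) : prodAt K E c h n one (-1, -1) = a n (b (-1, -1) one) := by
  rw [hch.prodAt_eq,
    hch.coeff_phi_left n (-1, -1) (fun Y Y' hY => hb.eq_zero (Or.inl fun hn => hY hn.isInt))
      (fun k Y' => hb.eq_zero (Or.inl (not_isNegInt_add_natCast (fun _ => rfl) k)))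
      (fun X X' hX => ha.eq_zero (Or.inl hX)) (isRel_phi _ _),
    hch.coeff_phi_right n (-1, -1) (fun Y Y' hY => hb.eq_zero (Or.inr fun hn => hY hn.isInt))
      (fun k Y' => hb.eq_zero (Or.inr (not_isNegInt_add_natCast (fun _ => rfl) k)))
      (fun X X' hX => ha.eq_zero (Or.inr hX)) (isRel_iota _), hch.coeff_iota]
  simp

theorem IsOPE.prodAt_snd_eq_zero (hch : IsOPE K E pa pb a b c h)
    (ha : CreativeD K E T Tb (ev1 K E a one)) (hb : CreativeD K E T Tb (ev1 K E b one))
    (hat : TransCov K E T Tb a) (hbt : TransCov K E T Tb b) (n : Idx K) (m : K) :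
    prodAt K E c h n (Tb one) (-1, m) = 0 := by
  have hneg : ∀ {x : K}, ¬ IsNegInt K x → ∀ k : ℕ, x ≠ -1 - ((k + 1 : ℕ) : K) := fun hx k hk =>
    hx (isNegInt_iff.mpr ⟨k + 1, by rw [hk]; ring⟩)
  rw [hch.prodAt_eq, hch.coeff_phi_left n (-1, m)
    (fun Y Y' hY => hb.apply_snd hbt (hneg fun hn => hY hn.isInt))
    (fun k Y' => hb.apply_snd hbt (hneg (not_isNegInt_add_natCast (fun _ => rfl) k)))
    (fun X X' hX => ha.apply_snd hat (hneg hX)) (isRel_phi _ _)]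
  refine hch.coeff_iota_left_eq_zero (fun Y' => hb.apply_snd hbt fun k hk => ?_) _ (isRel_phi _ _)
  have : ((k + 1 : ℕ) : K) = 0 := by linear_combination hk
  rw [Nat.cast_eq_zero] at this
  omega

/-- A translation covariant family of distributions that kills the translates of a vector creates
the states prescribed by the translation operators. -/
theorem TransCovAt.apply_natCast {P : E → Dist1 K E} (hP : TransCovAt K E T Tb P) {v : E}
    (hT : ∀ m, P (T v) m = 0) (hTb : ∀ m : K, P (Tb v) (-1, m) = 0) (i j : ℕ) :
    P v (-(i : K) - 1, -(j : K) - 1) =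
      ((i.factorial : K)⁻¹ * (j.factorial : K)⁻¹) • (T ^ i * Tb ^ j) (P v (-1, -1)) := by
  have step : ∀ {k : ℕ} {x y : E}, -(-(k : K) - 1) • y = x → y = ((k : K) + 1)⁻¹ • x := by
    intro k x y hxy
    have h1 : (k : K) + 1 ≠ 0 := by exact_mod_cast k.succ_ne_zero
    rw [← hxy, neg_sub', neg_neg, sub_neg_eq_add, inv_smul_smul₀ h1]
  induction i with
  | zero =>
    induction j with
    | zero => simp
    | succ j ih =>
      have e := hP.2 v (-((0 : ℕ) : K) - 1, -(j : K) - 1)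
      simp only [Nat.cast_zero, neg_zero, zero_sub] at e ih ⊢
      rw [hTb, sub_zero] at e
      rw [show -((j + 1 : ℕ) : K) - 1 = -(j : K) - 1 - 1 by push_cast; ring, step e.symm, ih,
        map_smul, smul_smul, pow_succ', pow_zero, one_mul, one_mul, Module.End.mul_apply,
        Nat.factorial_succ]
      push_cast
      congr 1
      rw [mul_inv]; ring
  | succ i ih =>
    have e := hP.1 v (-(i : K) - 1, -(j : K) - 1)
    rw [hT, sub_zero] at e
    rw [show -((i + 1 : ℕ) : K) - 1 = -(i : K) - 1 - 1 by push_cast; ring, step e.symm, ih,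
      map_smul, smul_smul, pow_succ', mul_assoc, Module.End.mul_apply, Nat.factorial_succ]
    push_cast
    congr 1
    rw [mul_inv]; ring

end Creative

/-- products of creative, translation covariant local distributions
are creative and translation covariant, and s₁(a(𝐳)_(𝐧)b(𝐳)) = a_𝐧 (s₁ b(𝐳)). -/
theorem stmt_3 (K : Type*) [Field K] [CharZero K]
    (E : Type*) [AddCommGroup E] [Module K E]
    (evE odE : Submodule K E) (hgr : IsCompl evE odE)
    (one : E) (hone : one ∈ evE)
    (T Tb : Module.End K E) (hT : EndPar K evE odE T 0) (hTb : EndPar K evE odE Tb 0)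
    (a b : EDist1 K E) (pa pb : ZMod 2)
    (ha : EDistPar K evE odE a pa) (hb : EDistPar K evE odE b pb)
    (hacre : CreativeD K E T Tb (ev1 K E a one))
    (hbcre : CreativeD K E T Tb (ev1 K E b one))
    (hatc : TransCov K E T Tb a) (hbtc : TransCov K E T Tb b)
    {r : ℕ} (c : Fin r → EDist2 K E) (h : Fin r → Idx K)
    (hch : IsOPE K E pa pb a b c h) :
    ∀ n : Idx K,
      CreativeD K E T Tb (prodAt K E c h n one) ∧
      TransCovAt K E T Tb (prodAt K E c h n) ∧
      prodAt K E c h n one ((-1 : K), (-1 : K)) = a n (b ((-1 : K), (-1 : K)) one) := by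
  intro n
  have ht : TransCovAt K E T Tb (prodAt K E c h n) :=
    ⟨hch.transCovAt_fst hatc.1 hbtc.1 n, hch.transCovAt_snd hatc.2 hbtc.2 n⟩
  refine ⟨⟨fun i => ?_, fun m hm => ?_⟩, ht, hch.prodAt_neg_one hacre hbcre n⟩
  · exact ht.apply_natCast (fun m => hch.prodAt_eq_zero (fun k => hbcre.apply_fst hbtc k) n m)
      (fun m => hch.prodAt_snd_eq_zero hacre hbcre hatc hbtc n m) i.1 i.2
  · refine hch.prodAt_eq_zero_of_creative hacre hbcre n ?_
    by_contra! hcon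
    obtain ⟨i, hi⟩ := isNegInt_iff.mp hcon.1
    obtain ⟨j, hj⟩ := isNegInt_iff.mp hcon.2
    exact hm ⟨(i, j), Prod.ext hi hj⟩

end OPEA
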